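/- arXiv:q-alg/9707028 — 2 statements merged into one kernel-verified Lean document; each statement's English description precedes it below -/
import Mathlib

section
/- Expansion of a factorial Schur polynomial in ordinary Schur polynomials: Let n ≥ 1 and let λ be a partition with at most n parts. Then s_λ(x|a) = Σ_{ν ⊆ λ} g_{λν}(a)·s_ν(x), where s_ν(x) is the ordinary Schur polynomial, the sum is over partitions ν contained in λ, and g_{λν}(a) = (−1)^{|λ|−|ν|} Σ_{T ∈ 𝒯(λ,ν)} ∏_{α unbarred} a_{T(α)+c(α)}. This is an identity in ℤ[a_i : i ∈ ℤ][x_1,…,x_n]. -/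
open scoped BigOperators

namespace FactorialLR

/-- Column order on cells: right-most column first, top to bottom within a column. -/
def ColLT (a b : ℕ × ℕ) : Prop :=
  b.2 < a.2 ∨ (a.2 = b.2 ∧ a.1 < b.1)

instance (a b : ℕ × ℕ) : Decidable (ColLT a b) := by
  unfold ColLT; infer_instance

/-- A filling of the cell set `s` with entries in `Fin n` (`0`-based, representing the
`1`-based entries `{1,…,n}`) is semistandard if it weakly increases along rows and strictly
increases down columns. -/
def IsSsyt {n : ℕ} (s : Finset (ℕ × ℕ)) (T : s → Fin n) : Prop :=
  (∀ c c' : s, (c : ℕ × ℕ).1 = (c' : ℕ × ℕ).1 → (c : ℕ × ℕ).2 ≤ (c' : ℕ × ℕ).2 → T c ≤ T c') ∧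
  (∀ c c' : s, (c : ℕ × ℕ).1 < (c' : ℕ × ℕ).1 → (c : ℕ × ℕ).2 = (c' : ℕ × ℕ).2 → T c < T c')

/-- The factorial Schur-type polynomial attached to a (possibly skew) cell set `s`:
`Σ_T ∏_{α ∈ s} (x_{T(α)} − a_{T(α)+c(α)})`, where `T` runs over semistandard fillings of `s`
with entries in `{1,…,n}` (stored `0`-based) and `c(α) = j − i` is the content of `α = (i,j)`.
Taking `a = 0` gives the ordinary Schur polynomial. -/
noncomputable def sgen {A : Type} [CommRing A] (n : ℕ) (s : Finset (ℕ × ℕ))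
    (x : Fin n → A) (a : ℤ → A) : A :=
  ∑ᶠ T ∈ {T : s → Fin n | IsSsyt s T},
    ∏ c : s, (x (T c) - a ((T c : ℤ) + 1 + ((c : ℕ × ℕ).2 : ℤ) - ((c : ℕ × ℕ).1 : ℤ)))

/-- `μ → ν` : `ν` is obtained from `μ` by adding a single cell. -/
def Covers (μ ν : YoungDiagram) : Prop :=
  μ ≤ ν ∧ ν.card = μ.card + 1

/-- Chains `μ = ρ⁽⁰⁾ → ρ⁽¹⁾ → ⋯ → ρ⁽ˡ⁾ = ν` of Young diagrams, encoded as lists. -/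
def chainSet (μ ν : YoungDiagram) : Set (List YoungDiagram) :=
  {L | L.Chain' Covers ∧ L.head? = some μ ∧ L.getLast? = some ν}

/-- The row (`0`-based) of the unique cell of `τ / σ`, when `σ → τ`. -/
def stepRow (σ τ : YoungDiagram) : ℕ :=
  (τ.cells \ σ.cells).sup Prod.fst

/-- The set `𝒯(θ,R)` for a sequence `R` (encoded as the list `L`): pairs `(T,β)` where `T`
is a semistandard filling of `s` and `β` lists the barred cells `α_1 < ⋯ < α_l` in column
order, with `T(α_i) = r_i` (the row of `ρ⁽ⁱ⁾/ρ⁽ⁱ⁻¹⁾`). -/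
def TSet {n : ℕ} (s : Finset (ℕ × ℕ)) (L : List YoungDiagram) :
    Set ((s → Fin n) × (Fin (L.length - 1) → s)) :=
  {p | IsSsyt s p.1 ∧
    (∀ i j : Fin (L.length - 1), i < j → ColLT (p.2 i : ℕ × ℕ) (p.2 j : ℕ × ℕ)) ∧
    (∀ i : Fin (L.length - 1),
      (p.1 (p.2 i) : ℕ) = stepRow (L.getD (i : ℕ) ⊥) (L.getD ((i : ℕ) + 1) ⊥))}

/-- `g_{λν}(a) = (−1)^{|λ|−|ν|} Σ_{T ∈ 𝒯(λ,ν)} ∏_{α unbarred} a_{T(α)+c(α)}`, an element of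
`ℤ[a_i : i ∈ ℤ][x_1,…,x_n]` (constant in the `x`'s). -/
noncomputable def gcoef (n : ℕ) (lam nu : YoungDiagram) : MvPolynomial (ℤ ⊕ Fin n) ℤ :=
  (-1 : MvPolynomial (ℤ ⊕ Fin n) ℤ) ^ (lam.card - nu.card) *
  ∑ᶠ L ∈ chainSet ⊥ nu,
    ∑ᶠ p ∈ TSet (n := n) lam.cells L,
      ∏ c : lam.cells,
        if ∃ i, p.2 i = c then 1
        else MvPolynomial.X
          (Sum.inl ((p.1 c : ℤ) + 1 + ((c : ℕ × ℕ).2 : ℤ) - ((c : ℕ × ℕ).1 : ℤ)))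

open Finset MvPolynomial

abbrev RR (n : ℕ) := MvPolynomial (ℤ ⊕ Fin n) ℤ

noncomputable def act {n : ℕ} (σ : Equiv.Perm (Fin n)) : RR n →ₐ[ℤ] RR n :=
  rename (Sum.map id σ)

noncomputable def xx {n : ℕ} (v : Fin n) : RR n := X (Sum.inr v)

lemma act_xx {n : ℕ} (σ : Equiv.Perm (Fin n)) (v : Fin n) : act σ (xx v) = xx (σ v) := by
  simp [act, xx]

lemma act_mul {n : ℕ} (σ τ : Equiv.Perm (Fin n)) (f : RR n) :
    act σ (act τ f) = act (σ * τ) f := by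
  simp only [act, rename_rename]
  congr 2
  ext x
  rcases x with x | x <;> simp

/-- number of elements of `C` below `t` -/
def cb {n : ℕ} (C : Finset (Fin n)) (t : ℕ) : ℕ := #{u ∈ C | u.val < t}

def cle {n : ℕ} (C' C : Finset (Fin n)) : Prop := ∀ t, cb C t ≤ cb C' t

lemma cb_succ {n : ℕ} (C : Finset (Fin n)) (v : Fin n) :
    cb C (v.val + 1) = cb C v.val + if v ∈ C then 1 else 0 := by
  unfold cb
  have : (C.filter fun u => u.val < v.val + 1)
      = (C.filter fun u => u.val < v.val) ∪ (C.filter fun u => u = v) := by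
    ext u; simp only [mem_filter, mem_union, Fin.ext_iff]; constructor
    · rintro ⟨h, h'⟩
      rcases Nat.lt_succ_iff_lt_or_eq.mp h' with h' | h'
      · left; exact ⟨h, h'⟩
      · right; exact ⟨h, h'⟩
    · rintro (⟨h, h'⟩ | ⟨h, h'⟩)
      · exact ⟨h, by omega⟩
      · exact ⟨h, by omega⟩
  rw [this, card_union_of_disjoint]
  · congr 1
    rw [filter_eq']
    split_ifs <;> simp
  · rw [disjoint_filter]
    rintro u _ h rfl
    omega

/-- index of the letter `v` in column `j` with content `C` -/
def ix {n : ℕ} (j : ℕ) (C : Finset (Fin n)) (v : Fin n) : ℤ :=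
  (v : ℤ) + 1 + (j : ℤ) - (cb C v.val : ℤ)

noncomputable def wt {n : ℕ} (a : ℤ → RR n) (j : ℕ) (C : Finset (Fin n)) : RR n :=
  ∏ v ∈ C, (xx v - a (ix j C v))

open Classical in
noncomputable def FF {n : ℕ} (a : ℤ → RR n) (l : ℕ → ℕ) : ℕ → Finset (Fin n) → RR n
  | 0, _ => 1
  | j + 1, C => ∑ C' : Finset (Fin n), if #C' = l j ∧ cle C' C then wt a j C' * FF a l j C' else 0

section LemA
variable {n : ℕ} (k0 k1 : Fin n)

def sw (C : Finset (Fin n)) : Finset (Fin n) := C.map (Equiv.swap k0 k1).toEmbedding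

variable {k0 k1}

lemma mem_sw {C : Finset (Fin n)} {v : Fin n} : v ∈ sw k0 k1 C ↔ Equiv.swap k0 k1 v ∈ C := by
  unfold sw
  rw [Finset.mem_map_equiv, Equiv.symm_swap]

lemma sw_sw (C : Finset (Fin n)) : sw k0 k1 (sw k0 k1 C) = C := by
  ext v; simp [mem_sw]

lemma card_sw (C : Finset (Fin n)) : #(sw k0 k1 C) = #C := by simp [sw]

lemma cb_sw (hk : k1.val = k0.val + 1) (C : Finset (Fin n)) (t : ℕ) (ht : t ≠ k1.val) :
    cb (sw k0 k1 C) t = cb C t := by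
  unfold cb
  have : (C.filter fun u => u.val < t) = sw k0 k1 ((sw k0 k1 C).filter fun u => u.val < t) := by
    ext v
    simp only [mem_filter, mem_sw, Equiv.swap_apply_self]
    refine and_congr_right fun _ => ?_
    rcases eq_or_ne v k0 with rfl | h0
    · simp; omega
    rcases eq_or_ne v k1 with rfl | h1
    · simp; omega
    rw [Equiv.swap_apply_of_ne_of_ne h0 h1]
  rw [this, card_sw]

lemma sw_eq (C : Finset (Fin n)) (h : k0 ∈ C ↔ k1 ∈ C) : sw k0 k1 C = C := by
  ext v
  rw [mem_sw]
  rcases eq_or_ne v k0 with rfl | h0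
  · simp [h]
  rcases eq_or_ne v k1 with rfl | h1
  · simp [h]
  rw [Equiv.swap_apply_of_ne_of_ne h0 h1]

lemma cle_sw (hk : k1.val = k0.val + 1) {C C' : Finset (Fin n)} (hC : k0 ∈ C → k1 ∈ C)
    (h : cle C' C) : cle (sw k0 k1 C') C := by
  by_cases hb : k0 ∈ C' ↔ k1 ∈ C'
  · rwa [sw_eq _ hb]
  intro t
  rcases eq_or_ne t k1.val with rfl | ht
  · have e1 := cb_succ C k0
    have e2 := cb_succ (sw k0 k1 C') k0
    have e3 := cb_succ C' k0
    have e4 := cb_succ C k1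
    have e5 := cb_succ C' k1
    have e6 := cb_sw hk C' k0.val (by omega)
    have e7 := h k0.val
    have e8 := h k1.val
    have e9 := h (k1.val + 1)
    rw [← hk] at e1 e2 e3
    simp only [mem_sw, Equiv.swap_apply_left] at e2
    split_ifs at * <;> simp_all <;> omega
  · rw [cb_sw hk _ _ ht]; exact h t

/-- weight without the letters k0 k1 -/
noncomputable def rw' (k0 k1 : Fin n) (a : ℤ → RR n) (j : ℕ) (C : Finset (Fin n)) : RR n :=
  ∏ v ∈ C with v ≠ k0 ∧ v ≠ k1, (xx v - a (ix j C v))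

def Sy (k0 k1 : Fin n) (f : RR n) : Prop := act (Equiv.swap k0 k1) f = f

lemma Sy.add {f g : RR n} (hf : Sy k0 k1 f) (hg : Sy k0 k1 g) : Sy k0 k1 (f + g) := by
  unfold Sy at *; rw [map_add, hf, hg]
lemma Sy.sub {f g : RR n} (hf : Sy k0 k1 f) (hg : Sy k0 k1 g) : Sy k0 k1 (f - g) := by
  unfold Sy at *; rw [map_sub, hf, hg]
lemma Sy.mul {f g : RR n} (hf : Sy k0 k1 f) (hg : Sy k0 k1 g) : Sy k0 k1 (f * g) := by
  unfold Sy at *; rw [map_mul, hf, hg]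
lemma Sy.one : Sy k0 k1 (1 : RR n) := by
  unfold Sy at *; rw [map_one]
lemma Sy.sum {ι : Type*} {s : Finset ι} {f : ι → RR n} (hf : ∀ i ∈ s, Sy k0 k1 (f i)) :
    Sy k0 k1 (∑ i ∈ s, f i) := by
  unfold Sy at *; rw [map_sum]; exact sum_congr rfl hf
lemma Sy.prod {ι : Type*} {s : Finset ι} {f : ι → RR n} (hf : ∀ i ∈ s, Sy k0 k1 (f i)) :
    Sy k0 k1 (∏ i ∈ s, f i) := by
  unfold Sy at *; rw [map_prod]; exact prod_congr rfl hf

variable {a : ℤ → RR n}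

lemma Sy_rw (ha : ∀ σ k, act σ (a k) = a k) (j : ℕ) (C : Finset (Fin n)) :
    Sy k0 k1 (rw' k0 k1 a j C) := by
  apply Sy.prod
  intro v hv
  simp only [mem_filter] at hv
  unfold Sy
  rw [map_sub, act_xx, ha, Equiv.swap_apply_of_ne_of_ne hv.2.1 hv.2.2]

lemma wt_eq (hk : k1.val = k0.val + 1) (j : ℕ) (C : Finset (Fin n)) :
    wt a j C = (if k0 ∈ C then xx k0 - a (ix j C k0) else 1) *
      (if k1 ∈ C then xx k1 - a (ix j C k1) else 1) * rw' k0 k1 a j C := by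
  have hne : k1 ≠ k0 := by intro h; rw [h] at hk; omega
  unfold wt rw'
  rw [← prod_filter_mul_prod_filter_not C (fun v => v = k0), filter_eq']
  rw [← prod_filter_mul_prod_filter_not (C.filter fun v => ¬ v = k0) (fun v => v = k1),
    filter_filter, filter_filter]
  have : (C.filter fun v => ¬ v = k0 ∧ v = k1) = if k1 ∈ C then {k1} else ∅ := by
    rw [← filter_eq']
    apply filter_congr
    intro v _
    constructor
    · exact fun h => h.2
    · rintro rfl; exact ⟨hne, rfl⟩
  rw [this, ← mul_assoc]
  congr 2
  · split_ifs <;> simp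
  · split_ifs <;> simp

lemma rw_sw (hk : k1.val = k0.val + 1) (j : ℕ) (C : Finset (Fin n)) :
    rw' k0 k1 a j (sw k0 k1 C) = rw' k0 k1 a j C := by
  unfold rw'
  have : ((sw k0 k1 C).filter fun v => v ≠ k0 ∧ v ≠ k1) = C.filter fun v => v ≠ k0 ∧ v ≠ k1 := by
    ext v
    simp only [mem_filter, mem_sw]
    refine and_congr_left fun h => ?_
    rw [Equiv.swap_apply_of_ne_of_ne h.1 h.2]
  rw [this]
  apply prod_congr rfl
  intro v hv
  simp only [mem_filter] at hv
  unfold ix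
  rw [cb_sw hk]
  intro h
  exact hv.2.2 (Fin.ext h)

lemma Sy_two {f : RR n} (h : Sy k0 k1 (f + f)) : Sy k0 k1 f := by
  unfold Sy at *
  rw [map_add, ← two_mul, ← two_mul] at h
  exact mul_left_cancel₀ two_ne_zero h

lemma Sy_wt (hk : k1.val = k0.val + 1) (ha : ∀ σ k, act σ (a k) = a k) (j : ℕ)
    (C : Finset (Fin n)) (h : k0 ∈ C ↔ k1 ∈ C) : Sy k0 k1 (wt a j C) := by
  rw [wt_eq hk]
  refine Sy.mul ?_ (Sy_rw ha _ _)
  by_cases h1 : k1 ∈ C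
  · have h0 := h.2 h1
    have : ix j C k1 = ix j C k0 := by
      unfold ix
      have e1 := cb_succ C k0
      rw [← hk, if_pos h0] at e1
      omega
    rw [if_pos h0, if_pos h1, this]
    unfold Sy
    simp only [map_mul, map_sub, act_xx, ha, Equiv.swap_apply_left, Equiv.swap_apply_right]
    ring
  · rw [if_neg h1, if_neg (fun h0 => h1 (h.1 h0)), one_mul]
    exact Sy.one

/-- key pair lemma -/
lemma pair_core (hk : k1.val = k0.val + 1) (ha : ∀ σ k, act σ (a k) = a k) (l : ℕ → ℕ) (j : ℕ)
    (C : Finset (Fin n)) (h0 : k0 ∉ C) (h1 : k1 ∈ C)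
    (hs : Sy k0 k1 (FF a l j C))
    (hd : ∃ g, Sy k0 k1 g ∧
      FF a l j C - FF a l j (sw k0 k1 C) = (xx k1 - a (ix j (sw k0 k1 C) k0)) * g) :
    Sy k0 k1 (wt a j C * FF a l j C + wt a j (sw k0 k1 C) * FF a l j (sw k0 k1 C)) := by
  obtain ⟨g, hg, e⟩ := hd
  have e' : FF a l j (sw k0 k1 C) =
    FF a l j C - (xx k1 - a (ix j (sw k0 k1 C) k0)) * g := by rw [← e]; ring
  have m0 : k0 ∈ sw k0 k1 C := by rw [mem_sw]; simpa using h1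
  have m1 : k1 ∉ sw k0 k1 C := by rw [mem_sw]; simpa using h0
  rw [wt_eq hk j C, wt_eq hk j (sw k0 k1 C), if_neg h0, if_pos h1, if_pos m0, if_neg m1, rw_sw hk, e']
  have hr := Sy_rw (k0 := k0) (k1 := k1) ha j C
  unfold Sy at *
  simp only [map_add, map_mul, map_sub, map_one, act_xx, ha, Equiv.swap_apply_left,
    Equiv.swap_apply_right, hr, hs, hg]
  ring

lemma diff_core (hk : k1.val = k0.val + 1) (ha : ∀ σ k, act σ (a k) = a k) (l : ℕ → ℕ) (j : ℕ)
    (ih : ∀ C, (k0 ∈ C → k1 ∈ C) → Sy k0 k1 (FF a l j C))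
    (C : Finset (Fin n)) (h0 : k0 ∉ C) (h1 : k1 ∈ C) : ∃ g, Sy k0 k1 g ∧
      FF a l (j+1) C - FF a l (j+1) (sw k0 k1 C) =
        (xx k1 - a (ix (j+1) (sw k0 k1 C) k0)) * g := by
  classical
  have m0 : k0 ∈ sw k0 k1 C := by rw [mem_sw]; simpa using h1
  have hc : ∀ t, t ≠ k1.val → cb (sw k0 k1 C) t = cb C t := cb_sw hk C
  have hc1 : cb (sw k0 k1 C) k1.val = cb C k1.val + 1 := by
    have e1 := cb_succ C k0
    have e2 := cb_succ (sw k0 k1 C) k0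
    rw [← hk] at e1 e2
    rw [if_neg h0] at e1
    rw [if_pos m0, hc k0.val (by omega)] at e2
    omega
  have key : ∀ C', cle C' C → ¬ cle C' (sw k0 k1 C) → k0 ∉ C' ∧ k1 ∈ C' ∧
      cb C' k1.val = cb C k0.val := by
    intro C' hC' hn
    have hlt : cb C' k1.val < cb (sw k0 k1 C) k1.val := by
      by_contra hcon
      apply hn
      intro t
      rcases eq_or_ne t k1.val with rfl | ht
      · omega
      · rw [hc t ht]; exact hC' t
    have e1 := cb_succ C k0
    have e3 := cb_succ C' k0
    have e4 := cb_succ C k1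
    have e5 := cb_succ C' k1
    have e7 := hC' k0.val
    have e8 := hC' k1.val
    have e9 := hC' (k1.val + 1)
    rw [← hk] at e1 e3
    rw [if_neg h0] at e1
    rw [if_pos h1] at e4
    refine ⟨?_, ?_, ?_⟩
    · intro hh; rw [if_pos hh] at e3; omega
    · by_contra hh; rw [if_neg hh] at e5; omega
    · omega
  have mono : ∀ C', cle C' (sw k0 k1 C) → cle C' C := by
    intro C' h t
    refine le_trans ?_ (h t)
    rcases eq_or_ne t k1.val with rfl | ht
    · omega
    · rw [hc t ht]
  refine ⟨∑ C' : Finset (Fin n), if #C' = l j ∧ cle C' C ∧ ¬ cle C' (sw k0 k1 C) then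
      rw' k0 k1 a j C' * FF a l j C' else 0, ?_, ?_⟩
  · apply Sy.sum
    intro C' _
    split_ifs with h
    · obtain ⟨p1, p2, p3⟩ := key C' h.2.1 h.2.2
      exact (Sy_rw ha _ _).mul (ih _ (fun _ => p2))
    · simp [Sy]
  · simp only [FF]
    rw [← sum_sub_distrib, mul_sum]
    apply sum_congr rfl
    intro C' _
    by_cases hl : #C' = l j
    swap
    · simp [hl]
    by_cases hs : cle C' (sw k0 k1 C)
    · simp [hs, mono C' hs]
    by_cases hs2 : cle C' C
    swap
    · simp [hs, hs2]
    obtain ⟨p1, p2, p3⟩ := key C' hs2 hs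
    simp only [hl, hs2, hs, and_self, if_true, and_false, if_false, not_false_eq_true, sub_zero]
    rw [wt_eq hk, if_neg p1, if_pos p2]
    have : ix j C' k1 = ix (j+1) (sw k0 k1 C) k0 := by
      unfold ix
      rw [p3, hc k0.val (by omega), hk]
      push_cast
      ring
    rw [this]
    ring

lemma lemA (hk : k1.val = k0.val + 1) (ha : ∀ σ k, act σ (a k) = a k) (l : ℕ → ℕ) (j : ℕ) :
    (∀ C, (k0 ∈ C → k1 ∈ C) → Sy k0 k1 (FF a l j C)) ∧
    (∀ C, k0 ∉ C → k1 ∈ C → Sy k0 k1 (wt a j C * FF a l j C +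
      wt a j (sw k0 k1 C) * FF a l j (sw k0 k1 C))) := by
  induction j with
  | zero =>
    refine ⟨fun C _ => by simpa [FF] using Sy.one, fun C h0 h1 => ?_⟩
    refine pair_core hk ha l 0 C h0 h1 (by simpa [FF] using Sy.one) ⟨0, ?_, ?_⟩
    · simp [Sy]
    · simp [FF]
  | succ j ih =>
    obtain ⟨ihA, ihB⟩ := ih
    have A : ∀ C, (k0 ∈ C → k1 ∈ C) → Sy k0 k1 (FF a l (j+1) C) := by
      classical
      intro C hC
      apply Sy_two
      set f : Finset (Fin n) → RR n := fun C' => if #C' = l j ∧ cle C' C then wt a j C' * FF a l j C' else 0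
        with hf
      have e1 : FF a l (j+1) C = ∑ C', f C' := by simp only [FF, hf]
      have e2 : FF a l (j+1) C = ∑ C', f (sw k0 k1 C') := by
        rw [e1]
        refine (Fintype.sum_equiv (Function.Involutive.toPerm (sw k0 k1) sw_sw) _ _ ?_).symm
        intro C'; rfl
      have e3 : FF a l (j+1) C + FF a l (j+1) C = ∑ C', (f C' + f (sw k0 k1 C')) := by
        rw [sum_add_distrib, ← e1, ← e2]
      rw [e3]
      apply Sy.sum
      intro C' _
      have hiff : cle (sw k0 k1 C') C ↔ cle C' C :=
        ⟨fun h => by simpa [sw_sw] using cle_sw hk hC h, fun h => cle_sw hk hC h⟩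
      simp only [hf, card_sw, hiff]
      split_ifs with h
      swap
      · simp [Sy]
      by_cases hb : k0 ∈ C' ↔ k1 ∈ C'
      · rw [sw_eq _ hb]
        have := (Sy_wt hk ha j C' hb).mul (ihA C' hb.1)
        exact this.add this
      by_cases h1 : k1 ∈ C'
      · have h0 : k0 ∉ C' := fun h0 => hb ⟨fun _ => h1, fun _ => h0⟩
        exact ihB C' h0 h1
      · have h0 : k0 ∈ C' := by
          by_contra h0
          exact hb ⟨fun h => absurd h h0, fun h => absurd h h1⟩
        have := ihB (sw k0 k1 C') (by rw [mem_sw]; simpa using h1) (by rw [mem_sw]; simpa using h0)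
        rw [sw_sw, add_comm] at this
        exact this
    refine ⟨A, fun C h0 h1 => ?_⟩
    exact pair_core hk ha l (j+1) C h0 h1 (A C (fun _ => h1)) (diff_core hk ha l j ihA C h0 h1)

end LemA

section AltSec
variable {n : ℕ}

noncomputable def Alt (f : RR n) : RR n :=
  ∑ σ : Equiv.Perm (Fin n), ((Equiv.Perm.sign σ : ℤ) : RR n) * act σ f

lemma Alt_add (f g : RR n) : Alt (f + g) = Alt f + Alt g := by
  simp [Alt, mul_add, sum_add_distrib]

lemma Alt_zero : Alt (0 : RR n) = 0 := by simp [Alt]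

lemma Alt_sum {ι : Type*} (s : Finset ι) (f : ι → RR n) :
    Alt (∑ i ∈ s, f i) = ∑ i ∈ s, Alt (f i) := by
  simp only [Alt, map_sum, mul_sum]
  exact sum_comm

lemma Alt_mul_sym (c f : RR n) (hc : ∀ σ, act σ c = c) : Alt (c * f) = c * Alt f := by
  simp only [Alt, map_mul, hc, mul_sum]
  exact sum_congr rfl fun σ _ => by ring

lemma Alt_swap {k0 k1 : Fin n} (hne : k0 ≠ k1) (f : RR n) (h : Sy k0 k1 f) : Alt f = 0 := by
  have e : Alt f = - Alt f := by
    conv_lhs => rw [Alt]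
    rw [← Equiv.sum_comp (Equiv.mulRight (Equiv.swap k0 k1)), Alt, ← sum_neg_distrib]
    refine sum_congr rfl fun σ _ => ?_
    simp only [Equiv.coe_mulRight, Equiv.Perm.sign_mul, Equiv.Perm.sign_swap hne]
    rw [← act_mul, h]
    simp
  have : (2 : RR n) * Alt f = 0 := by rw [two_mul]; nth_rewrite 1 [e]; ring
  exact (mul_eq_zero.mp this).resolve_left two_ne_zero

lemma act_one (f : RR n) : act 1 f = f := by
  have : (Sum.map id ⇑(1 : Equiv.Perm (Fin n)) : ℤ ⊕ Fin n → ℤ ⊕ Fin n) = id := by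
    ext x; rcases x with x | x <;> simp
  simp only [act, this, rename_id_apply]

lemma sym_all (f : RR n) (h : ∀ k0 k1 : Fin n, k1.val = k0.val + 1 → Sy k0 k1 f) (σ) :
    act σ f = f := by
  rcases n with _ | n
  · have : σ = 1 := Subsingleton.elim _ _
    rw [this, act_one]
  have hm : σ ∈ (⊤ : Submonoid (Equiv.Perm (Fin (n+1)))) := trivial
  rw [← Equiv.Perm.mclosure_swap_castSucc_succ] at hm
  induction hm using Submonoid.closure_induction with
  | mem x hx =>
    obtain ⟨i, rfl⟩ := hx
    exact h _ _ (by simp)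
  | one => exact act_one f
  | mul x y _ _ hx hy => rw [← act_mul, hy, hx]

noncomputable def xp (μ : Fin n → ℕ) : RR n := ∏ v, xx v ^ μ v

def dl (n : ℕ) (v : Fin n) : ℕ := n - 1 - v.val

lemma Sy_xp {k0 k1 : Fin n} (μ : Fin n → ℕ) (h : μ k0 = μ k1) : Sy k0 k1 (xp μ) := by
  unfold Sy xp
  rw [map_prod]
  simp only [map_pow, act_xx]
  rw [← Equiv.prod_comp (Equiv.swap k0 k1)]
  refine prod_congr rfl fun v _ => ?_
  rw [Equiv.swap_apply_self]
  rcases eq_or_ne v k0 with rfl | h0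
  · simp [h]
  rcases eq_or_ne v k1 with rfl | h1
  · simp [h]
  rw [Equiv.swap_apply_of_ne_of_ne h0 h1]

lemma xp_add (μ ν : Fin n → ℕ) : xp (μ + ν) = xp μ * xp ν := by
  simp [xp, pow_add, prod_mul_distrib]

/-- indicator -/
def ind (B : Finset (Fin n)) (v : Fin n) : ℕ := if v ∈ B then 1 else 0

lemma xp_ind (B : Finset (Fin n)) : xp (ind B) = ∏ v ∈ B, xx v := by
  simp [xp, ind, pow_ite, Finset.prod_ite_mem]

lemma Alt_dl_ne : Alt (xp (dl n)) ≠ 0 := by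
  have : Alt (xp (dl n)) = ((Matrix.vandermonde (xx : Fin n → RR n)).submatrix id Fin.revPerm).det := by
    rw [Matrix.det_apply']
    unfold Alt
    refine sum_congr rfl fun σ _ => ?_
    congr 1
    simp only [xp, map_prod, map_pow, act_xx, Matrix.submatrix_apply, Matrix.vandermonde_apply, id]
    refine prod_congr rfl fun v _ => ?_
    congr 1
    simp [dl, Fin.val_rev]
    omega
  rw [this, Matrix.det_permute']
  refine mul_ne_zero ?_ (Matrix.det_vandermonde_ne_zero_iff.mpr ?_)
  · rcases Int.units_eq_one_or (Equiv.Perm.sign (Fin.revPerm : Equiv.Perm (Fin n))) with h | h <;> simp [h]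
  · intro v w h
    simpa [xx] using h

noncomputable def uu (a : ℤ → RR n) (j : ℕ) (C B : Finset (Fin n)) : RR n :=
  ∏ v ∈ C \ B, (- a (ix j C v))

open Classical in
noncomputable def GG (a : ℤ → RR n) (l : ℕ → ℕ) : ℕ → (Fin n → ℕ) → Finset (Fin n) → RR n
  | 0, μ, _ => Alt (xp (dl n + μ))
  | j + 1, μ, C => ∑ e : Finset (Fin n) × Finset (Fin n),
      if (#e.1 = l j ∧ cle e.1 C) ∧ e.2 ⊆ e.1 ∧ Antitone (μ + ind e.2) then
        uu a j e.1 e.2 * GG a l j (μ + ind e.2) e.1 else 0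

lemma not_anti (μ : Fin n → ℕ) (h : ¬ Antitone μ) :
    ∃ k0 k1 : Fin n, k1.val = k0.val + 1 ∧ μ k0 < μ k1 := by
  rcases n with _ | n
  · exact absurd (fun i => i.elim0) h
  rw [Fin.antitone_iff_succ_le] at h
  push Not at h
  obtain ⟨i, hi⟩ := h
  exact ⟨_, _, by simp, hi⟩

lemma Alt_GG (a : ℤ → RR n) (ha : ∀ σ k, act σ (a k) = a k) (l : ℕ → ℕ) (j : ℕ) :
    ∀ (μ : Fin n → ℕ) (C : Finset (Fin n)), Antitone μ →
    Alt (xp (dl n + μ) * FF a l j C) = GG a l j μ C := by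
  classical
  induction j with
  | zero => intro μ C _; simp [FF, GG]
  | succ j ih =>
    intro μ C hμ
    have hu : ∀ C B σ, act σ (uu a j C B) = uu a j C B := by
      intro C B σ; simp [uu, map_prod, ha]
    simp only [FF, GG]
    rw [mul_sum, Alt_sum, Fintype.sum_prod_type]
    refine sum_congr rfl fun C' _ => ?_
    by_cases hC' : #C' = l j ∧ cle C' C
    swap
    · simp [hC', Alt_zero]
    simp only [hC', true_and, if_true, and_self]
    have e1 : wt a j C' = ∑ B ∈ C'.powerset, xp (ind B) * uu a j C' B := by
      unfold wt
      simp only [sub_eq_add_neg, prod_add, xp_ind, uu]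
    rw [e1, sum_mul, mul_sum, Alt_sum, ← Finset.sum_filter_add_sum_filter_not univ (fun B => B ⊆ C')]
    rw [Finset.sum_eq_zero (s := univ.filter fun B => ¬ B ⊆ C'), add_zero]
    swap
    · intro B hB
      simp only [mem_filter] at hB
      simp [hB.2]
    have : univ.filter (fun B => B ⊆ C') = C'.powerset := by ext B; simp
    rw [this]
    refine sum_congr rfl fun B hB => ?_
    rw [mem_powerset] at hB
    have e2 : xp (dl n + μ) * (xp (ind B) * uu a j C' B * FF a l j C')
        = uu a j C' B * (xp (dl n + (μ + ind B)) * FF a l j C') := by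
      rw [← add_assoc, xp_add (dl n + μ)]; ring
    rw [e2, Alt_mul_sym _ _ (hu C' B)]
    by_cases han : Antitone (μ + ind B)
    · simp [hB, han, ih _ C' han]
    · rw [if_neg (fun h => han h.2)]
      obtain ⟨k0, k1, hk, hlt⟩ := not_anti _ han
      have hle := hμ (show k0 ≤ k1 by rw [Fin.le_def]; omega)
      have hk1 := k1.isLt
      simp only [Pi.add_apply, ind] at hlt
      have h1 : k1 ∈ B := by
        by_contra h; simp [h] at hlt; split_ifs at hlt <;> omega
      have h0 : k0 ∉ B := by
        intro h; simp [h, h1] at hlt; omega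
      simp only [h1, h0, if_true, if_false] at hlt
      rw [Alt_swap (k0 := k0) (k1 := k1), mul_zero]
      · intro h; rw [h] at hk; omega
      · refine Sy.mul (Sy_xp _ ?_) ((lemA hk ha l j).1 C' (fun _ => hB h1))
        simp only [Pi.add_apply, ind, h1, h0, if_true, if_false, dl]
        omega

lemma FF_sym (a : ℤ → RR n) (ha : ∀ σ k, act σ (a k) = a k) (l : ℕ → ℕ) (j : ℕ) (σ) :
    act σ (FF a l j ∅) = FF a l j ∅ :=
  sym_all _ (fun _ _ hk => (lemA hk ha l j).1 ∅ (fun h => absurd h (notMem_empty _))) σ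

lemma main_alt (a : ℤ → RR n) (ha : ∀ σ k, act σ (a k) = a k) (l : ℕ → ℕ) (j : ℕ) :
    FF a l j ∅ * Alt (xp (dl n)) = GG a l j 0 ∅ := by
  rw [← Alt_GG a ha l j 0 ∅ (fun _ _ _ => le_rfl), ← Alt_mul_sym _ _ (FF_sym a ha l j), add_zero,
    mul_comm]

/-- validity of a sequence of columns -/
def Val (l : ℕ → ℕ) (j : ℕ) (D : Fin j → Finset (Fin n)) (C : Finset (Fin n)) : Prop :=
  ∀ i : Fin j, #(D i) = l i ∧ cle (D i) (Fin.snoc (α := fun _ => Finset (Fin n)) D C i.succ)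

lemma Val_snoc (l : ℕ → ℕ) (j : ℕ) (D : Fin j → Finset (Fin n)) (C' C : Finset (Fin n)) :
    Val l (j+1) (Fin.snoc (α := fun _ => Finset (Fin n)) D C') C ↔
      (#C' = l j ∧ cle C' C) ∧ Val l j D C' := by
  unfold Val
  rw [Fin.forall_fin_succ', and_comm]
  simp only [Fin.snoc_castSucc, Fin.snoc_last, Fin.val_last, Fin.val_castSucc, Fin.succ_last,
    Fin.succ_castSucc]

open Classical in
lemma FF_unroll (a : ℤ → RR n) (l : ℕ → ℕ) (j : ℕ) : ∀ C,
    FF a l j C = ∑ D : Fin j → Finset (Fin n), if Val l j D C then ∏ i : Fin j, wt a i (D i) else 0 := by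
  induction j with
  | zero => intro C; simp [FF, Val]
  | succ j ih =>
    intro C
    rw [← Equiv.sum_comp (Fin.snocEquiv (fun _ => Finset (Fin n))), Fintype.sum_prod_type]
    simp only [FF, Fin.snocEquiv, Equiv.coe_fn_mk]
    refine sum_congr rfl fun C' _ => ?_
    simp only [Val_snoc, Fin.prod_univ_castSucc, Fin.snoc_castSucc, Fin.snoc_last, Fin.val_castSucc,
      Fin.val_last]
    by_cases h : #C' = l j ∧ cle C' C
    · simp only [h, and_self, true_and, if_true]
      rw [ih, mul_sum]
      refine sum_congr rfl fun D _ => ?_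
      split_ifs
      · ring
      · ring
    · simp [h]

/-- validity of barred sequences -/
def ValB (l : ℕ → ℕ) (j : ℕ) (μ : Fin n → ℕ) (E : Fin j → Finset (Fin n) × Finset (Fin n))
    (C : Finset (Fin n)) : Prop :=
  Val l j (fun i => (E i).1) C ∧ ∀ i : Fin j, (E i).2 ⊆ (E i).1 ∧
    Antitone (μ + ∑ i' ∈ Finset.Ici i, ind (E i').2)

lemma ValB_snoc (l : ℕ → ℕ) (j : ℕ) (μ : Fin n → ℕ) (E : Fin j → Finset (Fin n) × Finset (Fin n))
    (e : Finset (Fin n) × Finset (Fin n)) (C : Finset (Fin n)) :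
    ValB l (j+1) μ (Fin.snoc (α := fun _ => Finset (Fin n) × Finset (Fin n)) E e) C ↔
      ((#e.1 = l j ∧ cle e.1 C) ∧ e.2 ⊆ e.1 ∧ Antitone (μ + ind e.2)) ∧
      ValB l j (μ + ind e.2) E e.1 := by
  unfold ValB
  have h1 : (fun i => (Fin.snoc (α := fun _ => Finset (Fin n) × Finset (Fin n)) E e i).1) =
      Fin.snoc (α := fun _ => Finset (Fin n)) (fun i => (E i).1) e.1 := by
    ext1 i
    refine Fin.lastCases ?_ (fun i => ?_) i <;> simp
  rw [h1, Val_snoc, Fin.forall_fin_succ']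
  have h2 : Finset.Ici (Fin.last j) = {Fin.last j} := by
    ext x; simp [Fin.last_le_iff]
  have h3 : ∀ i : Fin j, ∑ i' ∈ Finset.Ici i.castSucc,
      ind (Fin.snoc (α := fun _ => Finset (Fin n) × Finset (Fin n)) E e i').2
      = ind e.2 + ∑ i' ∈ Finset.Ici i, ind (E i').2 := by
    intro i
    have : Finset.Ici i.castSucc = insert (Fin.last j) ((Finset.Ici i).map Fin.castSuccEmb) := by
      ext x
      refine Fin.lastCases ?_ (fun x => ?_) x
      · simp [Fin.le_last]
      · simp [Fin.castSucc_ne_last]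
    rw [this, sum_insert (by simp [Fin.castSucc_ne_last]), sum_map]
    simp
  simp only [h2, h3, sum_singleton, Fin.snoc_castSucc, Fin.snoc_last, add_assoc]
  tauto

open Classical in
lemma GG_unroll (a : ℤ → RR n) (l : ℕ → ℕ) (j : ℕ) : ∀ μ C,
    GG a l j μ C = ∑ E : Fin j → Finset (Fin n) × Finset (Fin n), if ValB l j μ E C then
      (∏ i : Fin j, uu a i (E i).1 (E i).2) * Alt (xp (dl n + (μ + ∑ i, ind (E i).2))) else 0 := by
  induction j with
  | zero => intro μ C; simp [GG, ValB, Val]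
  | succ j ih =>
    intro μ C
    rw [← Equiv.sum_comp (Fin.snocEquiv (fun _ => Finset (Fin n) × Finset (Fin n))),
      Fintype.sum_prod_type]
    simp only [GG, Fin.snocEquiv, Equiv.coe_fn_mk]
    refine sum_congr rfl fun e _ => ?_
    simp only [ValB_snoc, Fin.prod_univ_castSucc, Fin.sum_univ_castSucc, Fin.snoc_castSucc,
      Fin.snoc_last, Fin.val_castSucc, Fin.val_last]
    by_cases h : (#e.1 = l j ∧ cle e.1 C) ∧ e.2 ⊆ e.1 ∧ Antitone (μ + ind e.2)
    · simp only [h, and_self, true_and, if_true]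
      rw [ih, mul_sum]
      refine sum_congr rfl fun D _ => ?_
      split_ifs
      · rw [add_comm (∑ i, ind (D i).2), add_assoc μ]; ring
      · ring
    · rw [if_neg h]
      symm
      apply sum_eq_zero
      intro D _
      rw [if_neg]
      exact fun hh => h hh.1

end AltSec

section Rigid
variable {n : ℕ}

lemma cb_mono (C : Finset (Fin n)) {s t : ℕ} (h : s ≤ t) : cb C s ≤ cb C t := by
  apply card_le_card
  intro u
  simp only [mem_filter]
  exact fun hu => ⟨hu.1, lt_of_lt_of_le hu.2 h⟩

lemma cb_inj (C : Finset (Fin n)) {v w : Fin n} (hv : v ∈ C) (hw : w ∈ C)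
    (h : cb C v.val = cb C w.val) : v = w := by
  have e1 := cb_succ C v
  have e2 := cb_succ C w
  rw [if_pos hv] at e1
  rw [if_pos hw] at e2
  rcases lt_trichotomy v.val w.val with h' | h' | h'
  · have := cb_mono C (show v.val + 1 ≤ w.val by omega); omega
  · exact Fin.ext h'
  · have := cb_mono C (show w.val + 1 ≤ v.val by omega); omega

lemma card_lt (s : ℕ) (hs : s ≤ n) : #{u : Fin n | u.val < s} = s := by
  rw [Fin.card_filter_val_lt]; omega

lemma cb_full (C : Finset (Fin n)) {s : ℕ} (hs : s ≤ n) (h : s ≤ cb C s) (t : Fin n)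
    (ht : t.val < s) : t ∈ C := by
  have hsub : (C.filter fun u => u.val < s) ⊆ ({u : Fin n | u.val < s} : Finset (Fin n)) := by
    intro u; simp
  have := eq_of_subset_of_card_le hsub (by rw [card_lt s hs]; exact h)
  have ht' : t ∈ ({u : Fin n | u.val < s} : Finset (Fin n)) := by simpa using ht
  rw [← this] at ht'
  exact (mem_filter.mp ht').1

lemma Val_iff (l : ℕ → ℕ) (m : ℕ) (D : Fin m → Finset (Fin n)) :
    Val l m D ∅ ↔ (∀ i, #(D i) = l i) ∧ ∀ i i', i ≤ i' → cle (D i) (D i') := by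
  constructor
  · intro h
    refine ⟨fun i => (h i).1, ?_⟩
    have step : ∀ d : ℕ, ∀ i i' : Fin m, i'.val = i.val + d → cle (D i) (D i') := by
      intro d
      induction d with
      | zero =>
        intro i i' e
        have : i = i' := Fin.ext (by omega)
        subst this
        exact fun t => le_rfl
      | succ d ih =>
        intro i i' e t
        have hlt : i.val + 1 < m := by have := i'.isLt; omega
        have h1 := (h i).2
        have e2 : i.succ = Fin.castSucc (⟨i.val+1, hlt⟩ : Fin m) := Fin.ext (by simp)
        rw [e2, Fin.snoc_castSucc] at h1
        exact (ih ⟨i.val+1, hlt⟩ i' (by simp; omega) t).trans (h1 t)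
    intro i i' hi
    exact step (i'.val - i.val) i i' (by rw [Fin.le_def] at hi; omega)
  · rintro ⟨h1, h2⟩ i
    refine ⟨h1 i, ?_⟩
    by_cases hlt : i.val + 1 < m
    · have e2 : i.succ = Fin.castSucc (⟨i.val+1, hlt⟩ : Fin m) := Fin.ext (by simp)
      rw [e2, Fin.snoc_castSucc]
      exact h2 _ _ (by rw [Fin.le_def]; simp)
    · have e2 : i.succ = Fin.last m := Fin.ext (by have := i.isLt; simp; omega)
      rw [e2, Fin.snoc_last]
      intro t; simp [cb]

lemma rigid (l : ℕ → ℕ) (m : ℕ) (E : Fin m → Finset (Fin n) × Finset (Fin n))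
    (h : ValB l m 0 E ∅) : ∀ p : ℕ, ∀ k : Fin n, k.val = p → ∀ i, k ∈ (E i).2 →
      ∀ t : Fin n, t ≤ k → t ∈ (E i).1 := by
  obtain ⟨hV, hB⟩ := h
  rw [Val_iff] at hV
  intro p
  induction p with
  | zero =>
    intro k hk i hki t ht
    have : t = k := Fin.ext (by rw [Fin.le_def] at ht; omega)
    subst this
    exact (hB i).1 hki
  | succ p ih =>
    intro k hk i hki t ht
    rcases eq_or_lt_of_le ht with rfl | ht
    · exact (hB i).1 hki
    have hkn := k.isLt
    set k' : Fin n := ⟨p, by omega⟩ with hk'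
    have h1 := (hB i).2 (show k' ≤ k by rw [Fin.le_def]; simp [hk']; omega)
    rw [zero_add, Finset.sum_apply, Finset.sum_apply] at h1
    have h2 : 1 ≤ ∑ i' ∈ Finset.Ici i, ind (E i').2 k := by
      refine le_trans ?_ (Finset.single_le_sum (f := fun i' => ind (E i').2 k)
        (fun _ _ => Nat.zero_le _) (Finset.mem_Ici.mpr (le_refl i)))
      simp [ind, hki]
    have h3 : ∃ i' ∈ Finset.Ici i, ind (E i').2 k' ≠ 0 := by
      apply Finset.exists_ne_zero_of_sum_ne_zero
      omega
    obtain ⟨i', hi', h4⟩ := h3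
    have h5 : k' ∈ (E i').2 := by
      by_contra hh; simp [ind, hh] at h4
    have h6 := ih k' rfl i' h5
    have h7 : p + 1 ≤ cb (E i').1 (p+1) := by
      have : ({u : Fin n | u.val < p+1} : Finset (Fin n)) ⊆ (E i').1.filter fun u => u.val < p+1 := by
        intro u hu
        simp only [mem_filter, mem_univ, true_and] at hu ⊢
        exact ⟨h6 u (by rw [Fin.le_def]; simp [hk']; omega), hu⟩
      have := card_le_card this
      rwa [card_lt _ (by omega)] at this
    have h8 := hV.2 i i' (Finset.mem_Ici.mp hi') (p+1)
    exact cb_full (E i).1 (s := p+1) (by omega) (h7.trans h8) t (by rw [Fin.lt_def] at ht; omega)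

lemma rigid_lt (l : ℕ → ℕ) (m : ℕ) (E : Fin m → Finset (Fin n) × Finset (Fin n))
    (h : ValB l m 0 E ∅) (k : Fin n) (i : Fin m) (hk : k ∈ (E i).2) : k.val < l i := by
  have h1 := rigid l m E h k.val k rfl i hk
  have h2 : #(E i).1 = l i := ((Val_iff l m _).1 h.1).1 i
  rw [← h2]
  have : ({u : Fin n | u.val < k.val+1} : Finset (Fin n)) ⊆ (E i).1 := by
    intro u hu
    simp only [mem_filter, mem_univ, true_and] at hu
    exact h1 u (by rw [Fin.le_def]; omega)
  have := card_le_card this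
  rw [card_lt _ (by have := k.isLt; omega)] at this
  omega

def stdc (n s : ℕ) : Finset (Fin n) := {u : Fin n | u.val < s}

lemma GG_zero (l : ℕ → ℕ) (hl : ∀ i i', i ≤ i' → l i' ≤ l i) (hn : l 0 ≤ n) (m : ℕ) :
    GG (n := n) (fun _ => 0) l m 0 ∅ = Alt (xp (dl n + ∑ i : Fin m, ind (stdc n (l i)))) := by
  classical
  have hln : ∀ i, l i ≤ n := fun i => (hl 0 i (Nat.zero_le i)).trans hn
  have hstd : ∀ i, #(stdc n (l i)) = l i := fun i => card_lt _ (hln i)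
  rw [GG_unroll, Finset.sum_eq_single (fun i : Fin m => (stdc n (l i), stdc n (l i)))]
  · rw [if_pos]
    · simp [uu]
    · refine ⟨(Val_iff _ _ _).2 ⟨fun i => hstd i, fun i i' hi t => ?_⟩, fun i => ⟨subset_rfl, ?_⟩⟩
      · apply card_le_card
        intro u
        simp only [mem_filter, stdc, mem_univ, true_and]
        have := hl i i' hi
        intro h; omega
      · intro v w hvw
        rw [zero_add, Finset.sum_apply, Finset.sum_apply]
        apply Finset.sum_le_sum
        intro i' _
        simp only [ind, stdc, mem_filter, mem_univ, true_and]
        rw [Fin.le_def] at hvw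
        split_ifs <;> omega
  · intro E _ hE
    split_ifs with hV
    swap
    · rfl
    have h1 : ∃ i, ¬ (E i).1 ⊆ (E i).2 := by
      by_contra hcon
      push Not at hcon
      apply hE
      funext i
      have e1 : (E i).1 = (E i).2 := subset_antisymm (hcon i) (hV.2 i).1
      have hc : #(E i).1 = l i := ((Val_iff l m _).1 hV.1).1 i
      have e2 : (E i).1 = stdc n (l i) := by
        apply eq_of_subset_of_card_le
        · intro k hk
          simp only [stdc, mem_filter, mem_univ, true_and]
          exact rigid_lt l m E hV k i (by rw [← e1]; exact hk)
        · rw [hc, hstd]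
      exact Prod.ext e2 (e1 ▸ e2)
    obtain ⟨i, hi⟩ := h1
    rw [Finset.not_subset] at hi
    obtain ⟨v, hv1, hv2⟩ := hi
    rw [Finset.prod_eq_zero (mem_univ i), zero_mul]
    unfold uu
    exact Finset.prod_eq_zero (i := v) (mem_sdiff.mpr ⟨hv1, hv2⟩) (by simp)
  · intro h; exact absurd (mem_univ _) h

end Rigid

section TD
variable {n : ℕ} {lam : YoungDiagram}

def colD (T : lam.cells → Fin n) (S : Finset lam.cells) (i : ℕ) : Finset (Fin n) :=
  (S.filter fun c => c.1.2 = i).image T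

lemma mem_colD {T : lam.cells → Fin n} {S : Finset lam.cells} {i : ℕ} {v : Fin n} :
    v ∈ colD T S i ↔ ∃ c ∈ S, c.1.2 = i ∧ T c = v := by
  simp only [colD, mem_image, mem_filter, and_assoc]

lemma col_inj {T : lam.cells → Fin n} (hT : IsSsyt lam.cells T) {c c' : lam.cells}
    (h : c.1.2 = c'.1.2) (h' : T c = T c') : c = c' := by
  rcases lt_trichotomy c.1.1 c'.1.1 with h1 | h1 | h1
  · have := hT.2 c c' h1 h; rw [h'] at this; exact absurd this (lt_irrefl _)
  · exact Subtype.ext (Prod.ext h1 h)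
  · have := hT.2 c' c h1 h.symm; rw [h'] at this; exact absurd this (lt_irrefl _)

lemma col_lt_iff {T : lam.cells → Fin n} (hT : IsSsyt lam.cells T) {c c' : lam.cells}
    (h : c.1.2 = c'.1.2) : T c < T c' ↔ c.1.1 < c'.1.1 := by
  constructor
  · intro h'
    rcases lt_trichotomy c.1.1 c'.1.1 with h1 | h1 | h1
    · exact h1
    · have : c = c' := Subtype.ext (Prod.ext h1 h)
      rw [this] at h'; exact absurd h' (lt_irrefl _)
    · exact absurd h' (not_lt_of_gt (hT.2 c' c h1 h.symm))
  · exact fun h' => hT.2 c c' h' h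

lemma cb_colD {T : lam.cells → Fin n} (hT : IsSsyt lam.cells T) (i t : ℕ) :
    cb (colD T univ i) t = #{c : lam.cells | c.1.2 = i ∧ (T c).val < t} := by
  unfold cb colD
  rw [filter_image, card_image_of_injOn, filter_filter]
  intro c hc c' hc' h
  simp only [coe_filter, mem_filter, mem_univ, true_and, Set.mem_ofPred_eq] at hc hc'
  exact col_inj hT (hc.1.trans hc'.1.symm) h

lemma card_col_lt (r i : ℕ) (hr : r ≤ lam.colLen i) :
    #{c : lam.cells | c.1.2 = i ∧ c.1.1 < r} = r := by
  conv_rhs => rw [← card_range r]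
  refine card_bij' (fun c _ => c.1.1)
    (fun q hq => ⟨(q, i), by
      rw [YoungDiagram.mem_cells, YoungDiagram.mem_iff_lt_colLen]
      exact lt_of_lt_of_le (mem_range.mp hq) hr⟩) ?_ ?_ ?_ ?_
  · intro c hc; simp only [mem_filter] at hc; simpa using hc.2.2
  · intro q hq; simpa using hq
  · intro c hc; simp only [mem_filter] at hc; exact Subtype.ext (Prod.ext rfl hc.2.1.symm)
  · intro q hq; rfl

lemma cell_lt (c : lam.cells) : c.1.1 < lam.colLen c.1.2 := by
  have := c.2
  rwa [YoungDiagram.mem_cells, ← Prod.mk.eta (p := c.1), YoungDiagram.mem_iff_lt_colLen] at this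

lemma cell_lt0 (c : lam.cells) : c.1.2 < lam.rowLen 0 := by
  have := c.2
  rw [YoungDiagram.mem_cells, ← Prod.mk.eta (p := c.1), YoungDiagram.mem_iff_lt_rowLen] at this
  exact this.trans_le (lam.rowLen_anti _ _ (Nat.zero_le _))

lemma cb_T {T : lam.cells → Fin n} (hT : IsSsyt lam.cells T) (c : lam.cells) :
    cb (colD T univ c.1.2) (T c).val = c.1.1 := by
  rw [cb_colD hT]
  rw [← card_col_lt (lam := lam) c.1.1 c.1.2 (cell_lt c).le]
  congr 1
  apply filter_congr
  intro c' _
  refine and_congr_right fun h => ?_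
  exact col_lt_iff hT h

lemma card_colD {T : lam.cells → Fin n} (hT : IsSsyt lam.cells T) (i : ℕ) :
    #(colD T univ i) = lam.colLen i := by
  unfold colD
  rw [card_image_of_injOn]
  · rw [← card_col_lt (lam := lam) (lam.colLen i) i le_rfl]
    congr 1
    apply filter_congr
    intro c _
    constructor
    · rintro rfl; exact ⟨rfl, cell_lt c⟩
    · exact fun h => h.1
  · intro c hc c' hc' h
    simp only [coe_filter, mem_univ, true_and, Set.mem_ofPred_eq] at hc hc'
    exact col_inj hT (hc.trans hc'.symm) h

lemma cle_colD {T : lam.cells → Fin n} (hT : IsSsyt lam.cells T) {i i' : ℕ} (h : i ≤ i') :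
    cle (colD T univ i) (colD T univ i') := by
  intro t
  rw [cb_colD hT, cb_colD hT]
  refine card_le_card_of_injOn (fun c => if h' : i ≤ c.1.2 then
    ⟨(c.1.1, i), lam.up_left_mem le_rfl h' c.2⟩ else c) ?_ ?_
  · intro c hc
    simp only [coe_filter, mem_univ, true_and, Set.mem_ofPred_eq] at hc ⊢
    rw [dif_pos (by omega)]
    refine ⟨rfl, lt_of_le_of_lt ?_ hc.2⟩
    exact hT.1 _ _ rfl (by simp; omega)
  · intro c hc c' hc' e
    simp only [coe_filter, mem_univ, true_and, Set.mem_ofPred_eq] at hc hc'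
    simp only [dif_pos (show i ≤ c.1.2 by omega), dif_pos (show i ≤ c'.1.2 by omega),
      Subtype.mk.injEq, Prod.mk.injEq, and_true] at e
    exact Subtype.ext (Prod.ext e (by omega))

lemma T_ext {T T' : lam.cells → Fin n} (hT : IsSsyt lam.cells T) (hT' : IsSsyt lam.cells T')
    (h : ∀ i : Fin (lam.rowLen 0), colD T univ i = colD T' univ i) : T = T' := by
  funext c
  have hc := h ⟨c.1.2, cell_lt0 c⟩
  have e1 := cb_T hT c
  have e2 := cb_T hT' c
  apply cb_inj (colD T univ c.1.2)
  · exact mem_colD.2 ⟨c, mem_univ _, rfl, rfl⟩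
  · rw [hc]; exact mem_colD.2 ⟨c, mem_univ _, rfl, rfl⟩
  · rw [e1]; rw [← hc] at e2; exact e2.symm

lemma cb_emb (C : Finset (Fin n)) {s : ℕ} (h : #C = s) (r : Fin s) :
    cb C (C.orderEmbOfFin h r).val = r.val := by
  have : (C.filter fun u => u.val < (C.orderEmbOfFin h r).val)
      = (Finset.Iio r).map (C.orderEmbOfFin h).toEmbedding := by
    ext u
    simp only [mem_filter, mem_map, mem_Iio, RelEmbedding.coe_toEmbedding]
    constructor
    · rintro ⟨hu, hlt⟩
      have : u ∈ Set.range (C.orderEmbOfFin h) := by rw [range_orderEmbOfFin]; exact hu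
      obtain ⟨q, rfl⟩ := this
      refine ⟨q, ?_, rfl⟩
      exact (C.orderEmbOfFin h).lt_iff_lt.mp hlt
    · rintro ⟨q, hq, rfl⟩
      exact ⟨orderEmbOfFin_mem _ _ _, (C.orderEmbOfFin h).lt_iff_lt.mpr hq⟩
  unfold cb
  rw [this, card_map]
  simp

lemma T_surj (D : Fin (lam.rowLen 0) → Finset (Fin n)) (hD : Val lam.colLen _ D ∅) :
    ∃ T : lam.cells → Fin n, IsSsyt lam.cells T ∧ ∀ i : Fin (lam.rowLen 0), colD T univ i = D i := by
  rw [Val_iff] at hD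
  obtain ⟨h1, h2⟩ := hD
  let T : lam.cells → Fin n := fun c =>
    (D ⟨c.1.2, cell_lt0 c⟩).orderEmbOfFin (h1 _) ⟨c.1.1, cell_lt c⟩
  have hcb : ∀ c, cb (D ⟨c.1.2, cell_lt0 c⟩) (T c).val = c.1.1 := fun c => cb_emb _ _ _
  have hmem : ∀ c, T c ∈ D ⟨c.1.2, cell_lt0 c⟩ := fun c => orderEmbOfFin_mem _ _ _
  have hS : IsSsyt lam.cells T := by
    constructor
    · intro c c' hr hc
      by_contra hcon
      rw [not_le, Fin.lt_def] at hcon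
      have e1 := hcb c
      have e2 := hcb c'
      have e3 := cb_succ (D ⟨c'.1.2, cell_lt0 c'⟩) (T c')
      rw [if_pos (hmem c')] at e3
      have e4 := h2 ⟨c.1.2, cell_lt0 c⟩ ⟨c'.1.2, cell_lt0 c'⟩ hc ((T c').val + 1)
      have e5 := cb_mono (D ⟨c.1.2, cell_lt0 c⟩) (show (T c').val + 1 ≤ (T c).val by omega)
      omega
    · intro c c' hr hc
      have e1 := hcb c
      have e2 := hcb c'
      have e3 : D ⟨c'.1.2, cell_lt0 c'⟩ = D ⟨c.1.2, cell_lt0 c⟩ := by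
        congr 1; exact Fin.ext hc.symm
      rw [e3] at e2
      by_contra hcon
      rw [not_lt, Fin.le_def] at hcon
      have e5 := cb_mono (D ⟨c.1.2, cell_lt0 c⟩) hcon
      omega
  refine ⟨T, hS, fun i => ?_⟩
  apply eq_of_subset_of_card_le
  · intro v hv
    obtain ⟨c, _, hc, rfl⟩ := mem_colD.1 hv
    have := hmem c
    have e3 : D ⟨c.1.2, cell_lt0 c⟩ = D i := by
      congr 1; exact Fin.ext hc
    rwa [e3] at this
  · rw [card_colD hS, h1]

lemma prod_cells {T : lam.cells → Fin n} (hT : IsSsyt lam.cells T) (f : ℕ → Fin n → RR n) :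
    ∏ c : lam.cells, f c.1.2 (T c) = ∏ i : Fin (lam.rowLen 0), ∏ v ∈ colD T univ i, f i v := by
  rw [← prod_fiberwise univ (fun c : lam.cells => (⟨c.1.2, cell_lt0 c⟩ : Fin (lam.rowLen 0)))]
  refine prod_congr rfl fun i _ => ?_
  unfold colD
  rw [prod_image]
  · have : (univ.filter fun c : lam.cells => (⟨c.1.2, cell_lt0 c⟩ : Fin (lam.rowLen 0)) = i)
      = univ.filter fun c : lam.cells => c.1.2 = i.val := by
      apply filter_congr; intro c _; simp [Fin.ext_iff]
    rw [this]
    refine prod_congr rfl fun c hc => ?_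
    simp only [mem_filter] at hc
    rw [hc.2]
  · intro c hc c' hc' h
    simp only [coe_filter, mem_univ, true_and, Set.mem_ofPred_eq] at hc hc'
    exact col_inj hT (hc.trans hc'.symm) h

lemma sgen_eq (a : ℤ → RR n) :
    sgen n lam.cells xx a = FF a lam.colLen (lam.rowLen 0) ∅ := by
  classical
  rw [FF_unroll, ← sum_filter]
  unfold sgen
  rw [finsum_mem_eq_finite_toFinset_sum _ (Set.toFinite _)]
  refine sum_bij (fun T _ => fun i : Fin (lam.rowLen 0) => colD T univ i) ?_ ?_ ?_ ?_
  · intro T hT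
    simp only [Set.Finite.mem_toFinset, Set.mem_ofPred_eq] at hT
    simp only [mem_filter, mem_univ, true_and]
    exact (Val_iff _ _ _).2 ⟨fun i => card_colD hT i, fun i i' h => cle_colD hT h⟩
  · intro T hT T' hT' h
    simp only [Set.Finite.mem_toFinset, Set.mem_ofPred_eq] at hT hT'
    exact T_ext hT hT' (fun i => congrFun h i)
  · intro D hD
    simp only [mem_filter, mem_univ, true_and] at hD
    obtain ⟨T, hT, h⟩ := T_surj D hD
    exact ⟨T, by simpa using hT, funext h⟩
  · intro T hT
    simp only [Set.Finite.mem_toFinset, Set.mem_ofPred_eq] at hT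
    rw [show (∏ i : Fin (lam.rowLen 0), wt a i (colD T univ i)) =
      ∏ c : lam.cells, (fun i v => xx v - a (ix i (colD T univ i) v)) c.1.2 (T c) from
      (prod_cells hT (fun i v => xx v - a (ix i (colD T univ i) v))).symm]
    refine prod_congr rfl fun c _ => ?_
    simp only [ix, cb_T hT]

lemma sum_ind_colD {T : lam.cells → Fin n} (hT : IsSsyt lam.cells T) (S : Finset lam.cells)
    (P : Finset (Fin (lam.rowLen 0))) (v : Fin n) :
    (∑ i ∈ P, ind (colD T S i)) v = #{c ∈ S | (⟨c.1.2, cell_lt0 c⟩ : Fin _) ∈ P ∧ T c = v} := by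
  rw [Finset.sum_apply]
  rw [card_eq_sum_card_fiberwise (f := fun c : lam.cells => (⟨c.1.2, cell_lt0 c⟩ : Fin _)) (t := P)]
  · refine sum_congr rfl fun i hi => ?_
    rw [filter_filter]
    unfold ind
    split_ifs with h
    · obtain ⟨c, hc, h1, h2⟩ := mem_colD.1 h
      symm
      rw [card_eq_one]
      refine ⟨c, ?_⟩
      ext c'
      simp only [mem_filter, mem_singleton]
      constructor
      · rintro ⟨_, ⟨_, h3⟩, h4⟩
        refine col_inj hT ?_ (h3.trans h2.symm)
        rw [h1, ← h4]
      · rintro rfl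
        have e : (⟨c'.1.2, cell_lt0 c'⟩ : Fin _) = i := Fin.ext h1
        exact ⟨hc, ⟨e ▸ hi, h2⟩, e⟩
    · symm
      rw [card_eq_zero, filter_eq_empty_iff]
      rintro c hc ⟨⟨_, h3⟩, h4⟩
      exact h (mem_colD.2 ⟨c, hc, by rw [← h4], h3⟩)
  · intro c hc
    simp only [coe_filter, Set.mem_ofPred_eq] at hc
    exact hc.2.1

/-- weight of a set of cells -/
def wS (T : lam.cells → Fin n) (S : Finset lam.cells) (v : Fin n) : ℕ := #{c ∈ S | T c = v}

/-- lattice pairs -/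
def Lat (T : lam.cells → Fin n) (S : Finset lam.cells) : Prop :=
  IsSsyt lam.cells T ∧ ∀ j : ℕ, Antitone (wS T (S.filter fun c => j ≤ c.1.2))

lemma ValB_colD {T : lam.cells → Fin n} {S : Finset lam.cells} (h : Lat T S) :
    ValB lam.colLen (lam.rowLen 0) 0 (fun i => (colD T univ i, colD T S i)) ∅ := by
  obtain ⟨hT, h⟩ := h
  refine ⟨(Val_iff _ _ _).2 ⟨fun i => card_colD hT i, fun i i' h => cle_colD hT h⟩, fun i => ⟨?_, ?_⟩⟩
  · intro v hv
    obtain ⟨c, hc, h1⟩ := mem_colD.1 hv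
    exact mem_colD.2 ⟨c, mem_univ _, h1⟩
  · rw [zero_add]
    convert h i.val using 1
    funext v
    rw [sum_ind_colD hT]
    simp only [wS, filter_filter, mem_Ici, Fin.le_def]

lemma GG_eq (a : ℤ → RR n) (Q : Finset ((lam.cells → Fin n) × Finset lam.cells))
    (hQ : ∀ q, q ∈ Q ↔ Lat q.1 q.2) :
    GG a lam.colLen (lam.rowLen 0) 0 ∅ = ∑ q ∈ Q,
      (∏ c : lam.cells, if c ∈ q.2 then 1 else
        - a ((q.1 c : ℤ) + 1 + ((c : ℕ × ℕ).2 : ℤ) - ((c : ℕ × ℕ).1 : ℤ))) *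
      Alt (xp (dl n + wS q.1 q.2)) := by
  classical
  rw [GG_unroll, ← sum_filter]
  symm
  refine sum_bij (fun q _ => fun i : Fin (lam.rowLen 0) => (colD q.1 univ i, colD q.1 q.2 i))
    ?_ ?_ ?_ ?_
  · intro q hq
    rw [hQ] at hq
    simp only [mem_filter, mem_univ, true_and]
    exact ValB_colD hq
  · rintro ⟨T, S⟩ hq ⟨T', S'⟩ hq' h
    rw [hQ] at hq hq'
    have hT := hq.1
    have h1 : T = T' := T_ext hq.1 hq'.1 (fun i => congrArg Prod.fst (congrFun h i))
    subst h1
    have h2 : ∀ i : Fin (lam.rowLen 0), colD T S i = colD T S' i :=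
      fun i => congrArg Prod.snd (congrFun h i)
    have h3 : ∀ S : Finset lam.cells, ∀ c, c ∈ S ↔ T c ∈ colD T S c.1.2 := by
      intro S c
      rw [mem_colD]
      constructor
      · exact fun h => ⟨c, h, rfl, rfl⟩
      · rintro ⟨c', hc', e1, e2⟩
        rwa [← col_inj hT e1 e2]
    congr 1
    ext c
    rw [h3 S, h3 S', h2 ⟨c.1.2, cell_lt0 c⟩]
  · intro E hE
    simp only [mem_filter, mem_univ, true_and] at hE
    obtain ⟨T, hT, h⟩ := T_surj _ hE.1
    let S : Finset lam.cells := univ.filter fun c => T c ∈ (E ⟨c.1.2, cell_lt0 c⟩).2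
    have hS : ∀ i : Fin (lam.rowLen 0), colD T S i = (E i).2 := by
      intro i
      ext v
      rw [mem_colD]
      constructor
      · rintro ⟨c, hc, h1, rfl⟩
        simp only [S, mem_filter, mem_univ, true_and] at hc
        have e : (⟨c.1.2, cell_lt0 c⟩ : Fin _) = i := Fin.ext h1
        rwa [e] at hc
      · intro hv
        have := (hE.2 i).1 hv
        rw [← h i] at this
        obtain ⟨c, _, h1, rfl⟩ := mem_colD.1 this
        refine ⟨c, ?_, h1, rfl⟩
        have e : (⟨c.1.2, cell_lt0 c⟩ : Fin _) = i := Fin.ext h1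
        simp only [S, mem_filter, mem_univ, true_and, e]
        exact hv
    refine ⟨(T, S), (hQ _).2 ⟨hT, fun j => ?_⟩, funext fun i => Prod.ext (h i) (hS i)⟩
    by_cases hj : j < lam.rowLen 0
    · have := (hE.2 ⟨j, hj⟩).2
      rw [zero_add] at this
      convert this using 1
      simp only [← hS]
      funext v
      rw [sum_ind_colD hT]
      simp only [wS, filter_filter, mem_Ici, Fin.le_def]
    · have : (S.filter fun c => j ≤ c.1.2) = ∅ := by
        rw [filter_eq_empty_iff]
        intro c _ hc
        exact hj (lt_of_le_of_lt hc (cell_lt0 c))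
      rw [this]
      intro v w _
      simp [wS]
  · rintro ⟨T, S⟩ hq
    rw [hQ] at hq
    have hT : IsSsyt lam.cells T := hq.1
    have h3 : ∀ c, c ∈ S ↔ T c ∈ colD T S c.1.2 := by
      intro c
      rw [mem_colD]
      constructor
      · exact fun h => ⟨c, h, rfl, rfl⟩
      · rintro ⟨c', hc', e1, e2⟩
        rwa [← col_inj hT e1 e2]
    congr 1
    · have := prod_cells hT (fun i v => if v ∈ colD T S i then 1 else - a (ix i (colD T univ i) v))
      calc _ = ∏ c : lam.cells, (fun i v => if v ∈ colD T S i then 1 else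
              - a (ix i (colD T univ i) v)) c.1.2 (T c) := by
            refine prod_congr rfl fun c _ => ?_
            simp only [ix, cb_T hT, ← h3 c]
        _ = _ := this
        _ = _ := by
          refine prod_congr rfl fun i _ => ?_
          unfold uu
          rw [sdiff_eq_filter, prod_filter]
          refine prod_congr rfl fun v _ => ?_
          simp only [ite_not]
    · congr 3
      rw [zero_add]
      funext v
      rw [sum_ind_colD hT]
      simp [wS]

end TD

section Chains

lemma colLT_irrefl (a : ℕ × ℕ) : ¬ ColLT a a := by
  unfold ColLT; omega
lemma colLT_trans {a b c : ℕ × ℕ} (h : ColLT a b) (h' : ColLT b c) : ColLT a c := by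
  unfold ColLT at *; omega
lemma colLT_tri (a b : ℕ × ℕ) : ColLT a b ∨ a = b ∨ ColLT b a := by
  unfold ColLT; rw [Prod.ext_iff]; omega

lemma rowLen_card (σ : YoungDiagram) (k : ℕ) : σ.rowLen k = #(σ.cells.filter fun c => c.1 = k) := by
  rw [YoungDiagram.rowLen_eq_card]; rfl

lemma cov_rowLen {σ τ : YoungDiagram} (h : Covers σ τ) (k : ℕ) :
    τ.rowLen k = σ.rowLen k + if k = stepRow σ τ then 1 else 0 := by
  obtain ⟨h1, h2⟩ := h
  have hsub : σ.cells ⊆ τ.cells := YoungDiagram.cells_subset_iff.2 h1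
  have hc : #(τ.cells \ σ.cells) = 1 := by
    rw [card_sdiff_of_subset hsub]
    change τ.card - σ.card = 1
    omega
  obtain ⟨c, hc⟩ := card_eq_one.1 hc
  have hcn : c ∉ σ.cells := by
    have : c ∈ τ.cells \ σ.cells := by rw [hc]; simp
    exact (mem_sdiff.1 this).2
  have ht : τ.cells = insert c σ.cells := by
    rw [← sdiff_union_of_subset hsub, hc]; rfl
  rw [rowLen_card, rowLen_card, stepRow, hc, sup_singleton, ht, filter_insert]
  by_cases hk : c.1 = k
  · rw [if_pos hk, if_pos hk.symm, card_insert_of_notMem]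
    simp [hcn]
  · rw [if_neg hk, if_neg (fun h => hk h.symm), add_zero]

lemma Y_le {σ τ : YoungDiagram} (h : ∀ k, σ.rowLen k ≤ τ.rowLen k) : σ ≤ τ := by
  rw [← YoungDiagram.cells_subset_iff]
  rintro ⟨i, j⟩ hc
  rw [YoungDiagram.mem_cells, YoungDiagram.mem_iff_lt_rowLen] at *
  exact lt_of_lt_of_le hc (h i)

lemma Y_ext {σ τ : YoungDiagram} (h : ∀ k, σ.rowLen k = τ.rowLen k) : σ = τ :=
  le_antisymm (Y_le fun k => (h k).le) (Y_le fun k => (h k).ge)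

lemma cov_of_rowLen {σ τ : YoungDiagram} (r : ℕ)
    (h : ∀ k, τ.rowLen k = σ.rowLen k + if k = r then 1 else 0) :
    Covers σ τ ∧ stepRow σ τ = r := by
  have hle : σ ≤ τ := Y_le fun k => by rw [h k]; omega
  have hn : (r, σ.rowLen r) ∉ σ.cells := by
    rw [YoungDiagram.mem_cells, YoungDiagram.mem_iff_lt_rowLen]; omega
  have ht : τ.cells = insert (r, σ.rowLen r) σ.cells := by
    ext ⟨i, j⟩
    rw [mem_insert, YoungDiagram.mem_cells, YoungDiagram.mem_cells, YoungDiagram.mem_iff_lt_rowLen,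
      YoungDiagram.mem_iff_lt_rowLen, h i, Prod.mk.injEq]
    by_cases hi : i = r
    · subst hi; simp; omega
    · simp [hi]
  refine ⟨⟨hle, ?_⟩, ?_⟩
  · change #τ.cells = #σ.cells + 1
    rw [ht, card_insert_of_notMem hn]
  · unfold stepRow
    rw [ht, insert_sdiff_of_notMem _ hn, sdiff_self]
    simp

def mkY (μ : ℕ → ℕ) (hμ : Antitone μ) (N : ℕ) : YoungDiagram where
  cells := (range N ×ˢ range (μ 0)).filter fun c => c.2 < μ c.1
  isLowerSet := by
    rintro ⟨i, j⟩ ⟨i', j'⟩ hle hm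
    simp only [Prod.mk_le_mk] at hle
    simp only [coe_filter, mem_product, mem_range, Set.mem_ofPred_eq] at hm ⊢
    have := hμ hle.1
    omega

lemma mkY_rowLen (μ : ℕ → ℕ) (hμ : Antitone μ) (N : ℕ) (h0 : ∀ k, N ≤ k → μ k = 0) (k : ℕ) :
    (mkY μ hμ N).rowLen k = μ k := by
  have : ∀ j, j < (mkY μ hμ N).rowLen k ↔ j < μ k := by
    intro j
    rw [← YoungDiagram.mem_iff_lt_rowLen, ← YoungDiagram.mem_cells]
    simp only [mkY, mem_filter, mem_product, mem_range]
    constructor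
    · exact fun h => h.2
    · intro h
      refine ⟨⟨?_, lt_of_lt_of_le h (hμ (Nat.zero_le k))⟩, h⟩
      by_contra hc
      rw [h0 k (by omega)] at h; omega
  have h1 := this (μ k)
  have h2 := this ((mkY μ hμ N).rowLen k)
  omega

variable {n : ℕ} {lam : YoungDiagram}

def pos (S : Finset lam.cells) (c : lam.cells) : ℕ := #{c' ∈ S | ColLT c'.1 c.1}

lemma pos_lt {S : Finset lam.cells} {c c' : lam.cells} (hc : c ∈ S) (h : ColLT c.1 c'.1) :
    pos S c < pos S c' := by
  apply card_lt_card
  rw [ssubset_iff_of_subset]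
  · exact ⟨c, by simp [hc, h], by simp [colLT_irrefl]⟩
  · intro d
    simp only [mem_filter]
    exact fun hd => ⟨hd.1, colLT_trans hd.2 h⟩

lemma pos_inj {S : Finset lam.cells} {c c' : lam.cells} (hc : c ∈ S) (hc' : c' ∈ S)
    (h : pos S c = pos S c') : c = c' := by
  rcases colLT_tri c.1 c'.1 with h1 | h1 | h1
  · have := pos_lt hc h1; omega
  · exact Subtype.ext h1
  · have := pos_lt hc' h1; omega

lemma pos_lt_iff {S : Finset lam.cells} {c c' : lam.cells} (hc : c ∈ S) (hc' : c' ∈ S) :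
    pos S c < pos S c' ↔ ColLT c.1 c'.1 := by
  constructor
  · intro h
    rcases colLT_tri c.1 c'.1 with h1 | h1 | h1
    · exact h1
    · rw [Subtype.ext h1] at h; omega
    · have := pos_lt hc' h1; omega
  · exact pos_lt hc

lemma pos_init {S U : Finset lam.cells} (hU : U ⊆ S)
    (hi : ∀ c ∈ U, ∀ c' ∈ S, ColLT c'.1 c.1 → c' ∈ U) {c : lam.cells} (hc : c ∈ S) :
    c ∈ U ↔ pos S c < #U := by
  constructor
  · intro h
    apply card_lt_card
    rw [ssubset_iff_of_subset]
    · exact ⟨c, h, by simp [colLT_irrefl]⟩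
    · intro d hd
      simp only [mem_filter] at hd
      exact hi c h d hd.1 hd.2
  · intro h
    by_contra hcU
    have : U ⊆ S.filter fun c' => ColLT c'.1 c.1 := by
      intro u hu
      rw [mem_filter]
      refine ⟨hU hu, ?_⟩
      rcases colLT_tri u.1 c.1 with h1 | h1 | h1
      · exact h1
      · exact absurd (Subtype.ext h1 ▸ hu) hcU
      · exact absurd (hi u hu c hc h1) hcU
    have := card_le_card this
    unfold pos at h
    omega

lemma pos_lt_card {S : Finset lam.cells} {c : lam.cells} (hc : c ∈ S) : pos S c < #S :=
  (pos_init (U := S) subset_rfl (fun _ _ _ h _ => h) hc).1 hc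

def Rr (T : lam.cells → Fin n) (S : Finset lam.cells) (i k : ℕ) : ℕ :=
  #{c ∈ S | pos S c < i ∧ (T c).val = k}

lemma Rr_zero (T : lam.cells → Fin n) (S : Finset lam.cells) (k : ℕ) : Rr T S 0 k = 0 := by
  simp [Rr]

lemma Rr_succ (T : lam.cells → Fin n) {S : Finset lam.cells} {c : lam.cells} (hc : c ∈ S) {i : ℕ}
    (hi : pos S c = i) (k : ℕ) :
    Rr T S (i+1) k = Rr T S i k + if k = (T c).val then 1 else 0 := by
  unfold Rr
  have : (S.filter fun d => pos S d < i + 1 ∧ (T d).val = k) =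
      (S.filter fun d => pos S d < i ∧ (T d).val = k) ∪ (if k = (T c).val then {c} else ∅) := by
    ext d
    simp only [mem_filter, mem_union]
    constructor
    · rintro ⟨h1, h2, h3⟩
      rcases Nat.lt_succ_iff_lt_or_eq.1 h2 with h4 | h4
      · exact Or.inl ⟨h1, h4, h3⟩
      · have : d = c := pos_inj h1 hc (by omega)
        subst this
        right; rw [if_pos h3.symm]; simp
    · rintro (⟨h1, h2, h3⟩ | h)
      · exact ⟨h1, by omega, h3⟩
      · split_ifs at h with hk
        · rw [mem_singleton] at h
          subst h
          exact ⟨hc, by omega, hk.symm⟩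
        · simp at h
  rw [this, card_union_of_disjoint]
  · congr 1
    split_ifs <;> simp
  · rw [disjoint_left]
    intro d hd hd'
    split_ifs at hd' with hk
    · rw [mem_singleton] at hd'
      subst hd'
      simp only [mem_filter] at hd
      omega
    · simp at hd'

lemma init_anti {T : lam.cells → Fin n} {S : Finset lam.cells} (h : Lat T S)
    {U : Finset lam.cells} (hU : U ⊆ S)
    (hi : ∀ c ∈ U, ∀ c' ∈ S, ColLT c'.1 c.1 → c' ∈ U) :
    Antitone fun k : ℕ => #{c ∈ U | (T c).val = k} := by
  apply antitone_nat_of_succ_le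
  intro k
  rcases (U.filter fun c => (T c).val = k + 1).eq_empty_or_nonempty with he | he
  · rw [he]; simp
  obtain ⟨c, hc, hmin⟩ := exists_min_image _ (fun c : lam.cells => c.1.2) he
  simp only [mem_filter] at hc
  have hk1 : k + 1 < n := by rw [← hc.2]; exact (T c).isLt
  have hl := h.2 c.1.2 (show (⟨k, by omega⟩ : Fin n) ≤ ⟨k+1, hk1⟩ by rw [Fin.le_def]; simp)
  unfold wS at hl
  refine le_trans (card_le_card ?_) (hl.trans (card_le_card ?_))
  · intro d hd
    have h2 := hmin d hd
    simp only [mem_filter] at hd ⊢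
    exact ⟨⟨hU hd.1, h2⟩, Fin.ext hd.2⟩
  · intro d hd
    simp only [mem_filter] at hd ⊢
    have hdk : (T d).val = k := by rw [hd.2]
    refine ⟨hi c hc.1 d hd.1.1 ?_, hdk⟩
    rcases Nat.lt_or_eq_of_le hd.1.2 with h3 | h3
    · left; exact h3
    · right
      refine ⟨h3.symm, (col_lt_iff h.1 h3.symm).1 ?_⟩
      rw [Fin.lt_def]; omega

lemma Rr_anti {T : lam.cells → Fin n} {S : Finset lam.cells} (h : Lat T S) (i : ℕ) :
    Antitone (Rr T S i) := by
  have := init_anti h (U := S.filter fun c => pos S c < i) (filter_subset _ _) (by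
    intro c hc c' hc' hlt
    simp only [mem_filter] at hc ⊢
    exact ⟨hc', (pos_lt hc' hlt).trans hc.2⟩)
  simp only [filter_filter] at this
  exact this

lemma Rr_big (T : lam.cells → Fin n) (S : Finset lam.cells) (i k : ℕ) (hk : n ≤ k) :
    Rr T S i k = 0 := by
  unfold Rr
  rw [card_eq_zero, filter_eq_empty_iff]
  rintro c _ ⟨_, h⟩
  have := (T c).isLt
  omega

lemma Rr_full (T : lam.cells → Fin n) (S : Finset lam.cells) (v : Fin n) :
    Rr T S (#S) v.val = wS T S v := by
  unfold Rr wS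
  congr 1
  apply filter_congr
  intro c hc
  rw [Fin.ext_iff]
  exact ⟨fun h => h.2, fun h => ⟨pos_lt_card hc, h⟩⟩

/-! chains -/

lemma chain_getD {L : List YoungDiagram} (h : L.Chain' Covers) {i : ℕ} (hi : i + 1 < L.length) :
    Covers (L.getD i ⊥) (L.getD (i+1) ⊥) := by
  rw [List.getD_eq_getElem _ _ (by omega), List.getD_eq_getElem _ _ hi]
  exact List.isChain_iff_getElem.1 h i hi

lemma chain_facts {ν : YoungDiagram} {L : List YoungDiagram} (h : L ∈ chainSet ⊥ ν) :
    0 < L.length ∧ L.getD 0 ⊥ = ⊥ ∧ L.getD (L.length - 1) ⊥ = ν := by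
  obtain ⟨h1, h2, h3⟩ := h
  rcases L with _ | ⟨Y, L⟩
  · simp at h2
  refine ⟨by simp, ?_, ?_⟩
  · simpa using h2
  · rw [List.getLast?_eq_getElem?] at h3
    rw [List.getD_eq_getElem?_getD, h3]
    rfl

lemma chain_card {ν : YoungDiagram} {L : List YoungDiagram} (h : L ∈ chainSet ⊥ ν) (i : ℕ)
    (hi : i < L.length) : (L.getD i ⊥).card = i := by
  induction i with
  | zero => rw [(chain_facts h).2.1]; rfl
  | succ i ih => rw [(chain_getD h.1 hi).2, ih (by omega)]

lemma chain_len {ν : YoungDiagram} {L : List YoungDiagram} (h : L ∈ chainSet ⊥ ν) :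
    L.length = ν.card + 1 := by
  have h1 := chain_facts h
  have h2 := chain_card h (L.length - 1) (by omega)
  rw [h1.2.2] at h2
  omega

lemma chain_le {ν : YoungDiagram} {L : List YoungDiagram} (h : L ∈ chainSet ⊥ ν) (d : ℕ) :
    ∀ i, i + d + 1 = L.length → L.getD i ⊥ ≤ ν := by
  induction d with
  | zero =>
    intro i hi
    have h1 := chain_facts h
    rw [show i = L.length - 1 by omega, h1.2.2]
  | succ d ih =>
    intro i hi
    exact (chain_getD h.1 (by omega)).1.trans (ih (i+1) (by omega))

lemma finite_Iic (ν : YoungDiagram) : {Y : YoungDiagram | Y ≤ ν}.Finite := by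
  apply Set.Finite.of_finite_image (f := YoungDiagram.cells)
  · apply Set.Finite.subset (ν.cells.powerset.finite_toSet)
    rintro _ ⟨Y, hY, rfl⟩
    simp only [coe_powerset, Set.mem_preimage, Set.mem_powerset_iff, coe_subset]
    exact YoungDiagram.cells_subset_iff.2 hY
  · intro Y _ Y' _ h
    exact YoungDiagram.ext h

lemma finite_chain (ν : YoungDiagram) : (chainSet ⊥ ν).Finite := by
  have : Finite {Y : YoungDiagram // Y ≤ ν} := finite_Iic ν
  apply Set.Finite.subset ((List.finite_length_eq {Y : YoungDiagram // Y ≤ ν} (ν.card + 1)).image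
    (List.map Subtype.val))
  intro L hL
  have hmem : ∀ Y ∈ L, Y ≤ ν := by
    intro Y hY
    obtain ⟨i, hi, rfl⟩ := List.mem_iff_getElem.1 hY
    have := chain_le hL (L.length - 1 - i) i (by omega)
    rwa [List.getD_eq_getElem _ _ hi] at this
  refine ⟨L.attachWith _ hmem, ?_, ?_⟩
  · simp [chain_len hL]
  · simp

variable {ν : YoungDiagram}

lemma TSet_pos {L : List YoungDiagram} {p : (lam.cells → Fin n) × (Fin (L.length - 1) → lam.cells)}
    (hp : p ∈ TSet lam.cells L) (i : Fin (L.length - 1)) :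
    pos (univ.image p.2) (p.2 i) = i.val := by
  have hinj : Function.Injective p.2 := by
    intro a b hab
    rcases lt_trichotomy a b with h | h | h
    · have := hp.2.1 a b h; rw [hab] at this; exact absurd this (colLT_irrefl _)
    · exact h
    · have := hp.2.1 b a h; rw [hab] at this; exact absurd this (colLT_irrefl _)
  unfold pos
  rw [filter_image, card_image_of_injective _ hinj]
  have : (univ.filter fun a => ColLT (p.2 a).1 (p.2 i).1) = Finset.Iio i := by
    ext a
    simp only [mem_filter, mem_univ, true_and, mem_Iio]
    constructor
    · intro h
      by_contra hc
      rcases eq_or_lt_of_le (not_lt.1 hc) with h' | h'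
      · rw [h'] at h; exact colLT_irrefl _ h
      · exact colLT_irrefl _ (colLT_trans h (hp.2.1 _ _ h'))
    · exact hp.2.1 a i
  rw [this]; simp

lemma TSet_card {L : List YoungDiagram} {p : (lam.cells → Fin n) × (Fin (L.length - 1) → lam.cells)}
    (hp : p ∈ TSet lam.cells L) : #(univ.image p.2) = L.length - 1 := by
  rw [card_image_of_injective]
  · simp
  intro a b hab
  have h1 := TSet_pos hp a
  have h2 := TSet_pos hp b
  rw [hab] at h1
  exact Fin.ext (by omega)

lemma chain_Rr {L : List YoungDiagram} (hL : L ∈ chainSet ⊥ ν)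
    {p : (lam.cells → Fin n) × (Fin (L.length - 1) → lam.cells)}
    (hp : p ∈ TSet lam.cells L) (i : ℕ) (hi : i < L.length) (k : ℕ) :
    (L.getD i ⊥).rowLen k = Rr p.1 (univ.image p.2) i k := by
  induction i with
  | zero =>
    rw [(chain_facts hL).2.1, Rr_zero, rowLen_card]; simp
  | succ i ih =>
    have hi' : i < L.length - 1 := by omega
    rw [cov_rowLen (chain_getD hL.1 hi), ih (by omega),
      Rr_succ p.1 (c := p.2 ⟨i, hi'⟩) (by simp) (TSet_pos hp ⟨i, hi'⟩), hp.2.2 ⟨i, hi'⟩]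

def rl (n : ℕ) (ν : YoungDiagram) (v : Fin n) : ℕ := ν.rowLen v.val

lemma chain_Lat {L : List YoungDiagram} (hL : L ∈ chainSet ⊥ ν)
    {p : (lam.cells → Fin n) × (Fin (L.length - 1) → lam.cells)}
    (hp : p ∈ TSet lam.cells L) :
    Lat p.1 (univ.image p.2) ∧ wS p.1 (univ.image p.2) = rl n ν := by
  have hf := chain_facts hL
  have hcard := TSet_card hp
  refine ⟨⟨hp.1, fun j => ?_⟩, ?_⟩
  · set S := univ.image p.2 with hS
    set U := S.filter fun c => j ≤ c.1.2 with hU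
    have hsub : U ⊆ S := filter_subset _ _
    have hi : ∀ c ∈ U, ∀ c' ∈ S, ColLT c'.1 c.1 → c' ∈ U := by
      intro c hc c' hc' hlt
      simp only [hU, mem_filter] at hc ⊢
      refine ⟨hc', ?_⟩
      have := hc.2
      unfold ColLT at hlt
      omega
    have hUc : #U < L.length := by
      have := card_le_card hsub
      omega
    have key : ∀ v : Fin n, wS p.1 U v = (L.getD (#U) ⊥).rowLen v.val := by
      intro v
      rw [chain_Rr hL hp _ hUc]
      unfold wS Rr
      congr 1
      ext c
      simp only [mem_filter, Fin.ext_iff]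
      constructor
      · rintro ⟨h1, h2⟩; exact ⟨hsub h1, (pos_init hsub hi (hsub h1)).1 h1, h2⟩
      · rintro ⟨h1, h2, h3⟩; exact ⟨(pos_init hsub hi h1).2 h2, h3⟩
    intro v w hvw
    rw [key, key]
    exact YoungDiagram.rowLen_anti _ _ _ hvw
  · funext v
    rw [← Rr_full, hcard, ← chain_Rr hL hp _ (by omega), hf.2.2]
    rfl

lemma chain_inj {L : List YoungDiagram} (hL : L ∈ chainSet ⊥ ν)
    {p : (lam.cells → Fin n) × (Fin (L.length - 1) → lam.cells)}
    (hp : p ∈ TSet lam.cells L) {L' : List YoungDiagram} (hL' : L' ∈ chainSet ⊥ ν)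
    {p' : (lam.cells → Fin n) × (Fin (L'.length - 1) → lam.cells)}
    (hp' : p' ∈ TSet lam.cells L') (h1 : p.1 = p'.1) (h2 : univ.image p.2 = univ.image p'.2) :
    (⟨L, p⟩ : Σ L : List YoungDiagram, (lam.cells → Fin n) × (Fin (L.length - 1) → lam.cells))
      = ⟨L', p'⟩ := by
  have hl : L.length = L'.length := by rw [chain_len hL, chain_len hL']
  have hLL : L = L' := by
    apply List.ext_getElem hl
    intro i hi hi'
    apply Y_ext
    intro k
    have e1 := chain_Rr hL hp i hi k
    have e2 := chain_Rr hL' hp' i hi' k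
    rw [List.getD_eq_getElem _ _ hi] at e1
    rw [List.getD_eq_getElem _ _ hi'] at e2
    rw [e1, e2, h1, h2]
  subst hLL
  congr 1
  refine Prod.ext h1 (funext fun i => ?_)
  apply pos_inj (S := univ.image p.2) (by simp) (by rw [h2]; simp)
  rw [TSet_pos hp]
  rw [h2, TSet_pos hp']

lemma chain_surj (hlam : lam.colLen 0 ≤ n) (hν : ν ≤ lam) {T : lam.cells → Fin n}
    {S : Finset lam.cells} (h : Lat T S) (hw : wS T S = rl n ν) :
    ∃ L ∈ chainSet ⊥ ν, ∃ p : (lam.cells → Fin n) × (Fin (L.length - 1) → lam.cells),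
      p ∈ TSet lam.cells L ∧ p.1 = T ∧ univ.image p.2 = S := by
  classical
  let Y : ℕ → YoungDiagram := fun i => mkY (Rr T S i) (Rr_anti h i) n
  have hY : ∀ i k, (Y i).rowLen k = Rr T S i k := fun i k =>
    mkY_rowLen _ _ _ (fun k hk => Rr_big T S i k hk) k
  have hex : ∀ i, i < #S → ∃ c ∈ S, pos S c = i := by
    intro i hi
    obtain ⟨c, hc, h⟩ := surj_on_of_inj_on_of_card_le (s := S) (t := range #S) (fun c _ => pos S c)
      (fun c hc => mem_range.2 (pos_lt_card hc)) (fun c c' hc hc' e => pos_inj hc hc' e)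
      (by simp) i (mem_range.2 hi)
    exact ⟨c, hc, h.symm⟩
  choose e he1 he2 using hex
  have hstep : ∀ i (hi : i < #S), Covers (Y i) (Y (i+1)) ∧ stepRow (Y i) (Y (i+1)) = (T (e i hi)).val := by
    intro i hi
    apply cov_of_rowLen
    intro k
    rw [hY, hY, Rr_succ T (he1 i hi) (he2 i hi)]
  have hlast : Y #S = ν := by
    apply Y_ext
    intro k
    rw [hY]
    by_cases hk : k < n
    · have := congrFun hw ⟨k, hk⟩
      rw [← Rr_full] at this
      exact this
    · rw [Rr_big T S _ k (by omega)]
      symm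
      by_contra hc
      have h1 : (k, 0) ∈ ν := YoungDiagram.mem_iff_lt_rowLen.2 (by omega)
      have h2 : (k, 0) ∈ lam := hν h1
      rw [YoungDiagram.mem_iff_lt_colLen] at h2
      omega
  have hfirst : Y 0 = ⊥ := by
    apply Y_ext
    intro k
    rw [hY, Rr_zero, rowLen_card]; simp
  let L : List YoungDiagram := (List.range (#S + 1)).map Y
  have hlen : L.length = #S + 1 := by simp [L]
  have hget : ∀ i, i < #S + 1 → L.getD i ⊥ = Y i := by
    intro i hi
    rw [List.getD_eq_getElem _ _ (by omega)]
    simp [L]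
  have hget' : ∀ i (hi : i < L.length), L[i] = Y i := by
    intro i hi
    simp [L]
  refine ⟨L, ⟨?_, ?_, ?_⟩, (T, fun i => e i.val (by have := i.isLt; omega)), ⟨h.1, ?_, ?_⟩, rfl, ?_⟩
  · refine List.isChain_iff_getElem.2 fun i hi => ?_
    rw [hget', hget']
    exact (hstep i (by omega)).1
  · rw [List.head?_eq_getElem?, List.getElem?_eq_getElem (by omega), hget', hfirst]
  · rw [List.getLast?_eq_getElem?, List.getElem?_eq_getElem (by omega), hget', hlen]
    simp [hlast]
  · intro i j hij
    rw [← pos_lt_iff (S := S) (he1 _ _) (he1 _ _), he2, he2]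
    exact hij
  · intro i
    have hi : i.val < #S := by have := i.isLt; omega
    rw [hget _ (by omega), hget _ (by omega)]
    exact (hstep i.val hi).2.symm
  · ext c
    simp only [mem_image, mem_univ, true_and]
    constructor
    · rintro ⟨i, rfl⟩; exact he1 _ _
    · intro hc
      refine ⟨⟨pos S c, by have := pos_lt_card hc; omega⟩, ?_⟩
      exact pos_inj (he1 _ _) hc (he2 _ _)

noncomputable def wq (q : (lam.cells → Fin n) × Finset lam.cells) : RR n :=
  ∏ c : lam.cells, if c ∈ q.2 then 1 else
    - (X (Sum.inl ((q.1 c : ℤ) + 1 + ((c : ℕ × ℕ).2 : ℤ) - ((c : ℕ × ℕ).1 : ℤ))) : RR n)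

lemma gcoef_eq (hlam : lam.colLen 0 ≤ n) (hν : ν ≤ lam)
    (Q : Finset ((lam.cells → Fin n) × Finset lam.cells)) (hQ : ∀ q, q ∈ Q ↔ Lat q.1 q.2) :
    gcoef n lam ν = ∑ q ∈ Q with wS q.1 q.2 = rl n ν, wq q := by
  classical
  unfold gcoef
  rw [finsum_mem_eq_finite_toFinset_sum _ (finite_chain ν)]
  have e1 : ∀ L : List YoungDiagram, ∀ f : (lam.cells → Fin n) × (Fin (L.length - 1) → lam.cells) → RR n,
      ∑ᶠ p ∈ TSet (n := n) lam.cells L, f p = ∑ p ∈ (Set.toFinite (TSet (n := n) lam.cells L)).toFinset, f p :=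
    fun L f => finsum_mem_eq_finite_toFinset_sum _ _
  simp only [e1]
  rw [sum_sigma', mul_sum]
  refine sum_bij (fun x _ => (x.2.1, univ.image x.2.2)) ?_ ?_ ?_ ?_
  · rintro ⟨L, p⟩ hx
    simp only [mem_sigma, Set.Finite.mem_toFinset] at hx
    rw [mem_filter, hQ]
    exact chain_Lat hx.1 hx.2
  · rintro ⟨L, p⟩ hx ⟨L', p'⟩ hx' h
    simp only [mem_sigma, Set.Finite.mem_toFinset] at hx hx'
    exact chain_inj hx.1 hx.2 hx'.1 hx'.2 (congrArg Prod.fst h) (congrArg Prod.snd h)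
  · rintro ⟨T, S⟩ hq
    rw [mem_filter, hQ] at hq
    obtain ⟨L, hL, p, hp, h1, h2⟩ := chain_surj hlam hν hq.1 hq.2
    exact ⟨⟨L, p⟩, by simp only [mem_sigma, Set.Finite.mem_toFinset]; exact ⟨hL, hp⟩,
      Prod.ext h1 h2⟩
  · rintro ⟨L, p⟩ hx
    simp only [mem_sigma, Set.Finite.mem_toFinset] at hx
    have hc := TSet_card hx.2
    have hl := chain_len hx.1
    have hcard : lam.card - ν.card = #(univ.filter fun c : lam.cells => c ∉ univ.image p.2) := by
      rw [filter_not, card_sdiff_of_subset (filter_subset _ _)]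
      simp only [filter_univ_mem]
      rw [hc, hl, card_univ, Fintype.card_coe]
      rfl
    rw [hcard, wq, card_eq_sum_ones, ← prod_pow_eq_pow_sum]
    simp only [pow_one]
    rw [prod_filter, ← prod_mul_distrib]
    refine prod_congr rfl fun c _ => ?_
    by_cases h : ∃ i, p.2 i = c
    · have h' : c ∈ univ.image p.2 := by simpa using h
      simp only [h, h', if_true, not_true_eq_false, if_false, mul_one]
    · have h' : c ∉ univ.image p.2 := by simpa using h
      simp only [h, h', if_false, not_false_eq_true, if_true]
      ring

lemma Lat_exists {T : lam.cells → Fin n} {S : Finset lam.cells} (h : Lat T S) :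
    ∃ ν, ν ≤ lam ∧ wS T S = rl n ν := by
  refine ⟨mkY (Rr T S #S) (Rr_anti h _) n, ?_, ?_⟩
  · apply Y_le
    intro k
    rw [mkY_rowLen _ _ _ (fun k hk => Rr_big T S _ k hk)]
    rw [← card_range (lam.rowLen k)]
    refine card_le_card_of_injOn (fun c => c.1.2) ?_ ?_
    · intro c hc
      simp only [coe_filter, Set.mem_ofPred_eq] at hc
      have hr := rigid_lt _ _ _ (ValB_colD h) (T c) ⟨c.1.2, cell_lt0 c⟩
        (mem_colD.2 ⟨c, hc.1, rfl, rfl⟩)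
      simp only [coe_range, Set.mem_Iio]
      rw [← YoungDiagram.mem_iff_lt_rowLen, YoungDiagram.mem_iff_lt_colLen, ← hc.2.2]
      exact hr
    · intro c hc c' hc' e
      simp only [coe_filter, Set.mem_ofPred_eq] at hc hc'
      exact col_inj h.1 e (Fin.ext (hc.2.2.trans hc'.2.2.symm))
  · funext v
    unfold rl
    rw [mkY_rowLen _ _ _ (fun k hk => Rr_big T S _ k hk), Rr_full]

lemma rl_inj (hlam : lam.colLen 0 ≤ n) {ν ν' : YoungDiagram} (hν : ν ≤ lam) (hν' : ν' ≤ lam)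
    (h : rl n ν = rl n ν') : ν = ν' := by
  have hz : ∀ ν : YoungDiagram, ν ≤ lam → ∀ k, n ≤ k → ν.rowLen k = 0 := by
    intro ν hν k hk
    by_contra hc
    have h1 : (k, 0) ∈ ν := YoungDiagram.mem_iff_lt_rowLen.2 (by omega)
    have h2 : (k, 0) ∈ lam := hν h1
    rw [YoungDiagram.mem_iff_lt_colLen] at h2
    omega
  apply Y_ext
  intro k
  by_cases hk : k < n
  · exact congrFun h ⟨k, hk⟩
  · rw [hz ν hν k (by omega), hz ν' hν' k (by omega)]

lemma sum_stdc (ν : YoungDiagram) :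
    ∑ i : Fin (ν.rowLen 0), ind (stdc n (ν.colLen i)) = rl n ν := by
  funext v
  rw [Finset.sum_apply]
  simp only [ind, stdc, mem_filter, mem_univ, true_and, rl]
  simp only [← YoungDiagram.mem_iff_lt_colLen, YoungDiagram.mem_iff_lt_rowLen]
  rw [← card_filter, Fin.card_filter_val_lt]
  exact min_eq_right (ν.rowLen_anti _ _ (Nat.zero_le _))

lemma schur_alt (ν : YoungDiagram) (h : ν.colLen 0 ≤ n) :
    sgen n ν.cells (xx : Fin n → RR n) (fun _ => 0) * Alt (xp (dl n)) = Alt (xp (dl n + rl n ν)) := by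
  rw [sgen_eq, main_alt _ (by simp), GG_zero _ (fun i i' h => ν.colLen_anti i i' h) h, sum_stdc]

end Chains

theorem factorial_schur_expansion (n : ℕ) (hn : 1 ≤ n) (lam : YoungDiagram)
    (hlam : lam.colLen 0 ≤ n) :
    sgen n lam.cells
        (fun i => (MvPolynomial.X (Sum.inr i) : MvPolynomial (ℤ ⊕ Fin n) ℤ))
        (fun k => MvPolynomial.X (Sum.inl k)) =
    ∑ᶠ nu ∈ {nu : YoungDiagram | nu ≤ lam},
      gcoef n lam nu *
        sgen n nu.cells (fun i => MvPolynomial.X (Sum.inr i)) (fun _ => 0) := by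
  classical
  change sgen n lam.cells (xx : Fin n → RR n) _ = ∑ᶠ nu ∈ {nu : YoungDiagram | nu ≤ lam},
      gcoef n lam nu * sgen n nu.cells (xx : Fin n → RR n) (fun _ => 0)
  apply mul_right_cancel₀ (Alt_dl_ne (n := n))
  let Q : Finset ((lam.cells → Fin n) × Finset lam.cells) := univ.filter fun q => Lat q.1 q.2
  have hQ : ∀ q, q ∈ Q ↔ Lat q.1 q.2 := by intro q; simp [Q]
  rw [sgen_eq, main_alt _ (by intro σ k; simp [act]), GG_eq _ Q hQ,
    finsum_mem_eq_finite_toFinset_sum _ (finite_Iic lam), sum_mul]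
  have e : ∀ nu ∈ (finite_Iic lam).toFinset,
      gcoef n lam nu * sgen n nu.cells (xx : Fin n → RR n) (fun _ => 0) * Alt (xp (dl n)) =
      ∑ q ∈ Q, if wS q.1 q.2 = rl n nu then wq q * Alt (xp (dl n + wS q.1 q.2)) else 0 := by
    intro nu hnu
    have hnu : nu ≤ lam := by simpa using hnu
    have hcol : nu.colLen 0 ≤ n := by
      refine le_trans ?_ hlam
      by_contra hc
      have h1 : (lam.colLen 0, 0) ∈ nu := YoungDiagram.mem_iff_lt_colLen.2 (by omega)
      have h2 := YoungDiagram.mem_iff_lt_colLen.1 (hnu h1)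
      omega
    rw [mul_assoc, schur_alt nu hcol, gcoef_eq hlam hnu Q hQ, sum_mul, sum_filter]
    refine sum_congr rfl fun q _ => ?_
    split_ifs with h
    · rw [h]
    · rfl
  rw [sum_congr rfl e, sum_comm]
  refine sum_congr rfl fun q hq => ?_
  obtain ⟨ν, hν, hw⟩ := Lat_exists ((hQ q).1 hq)
  rw [sum_eq_single ν]
  · rw [if_pos hw]; rfl
  · intro ν' hν' hne
    rw [if_neg]
    intro h
    exact hne (rl_inj hlam (by simpa using hν') hν (h.symm.trans hw))
  · intro h
    exact absurd (by simpa using hν) h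

end FactorialLR
end

section
/- Let n ≥ 1, let θ be a skew diagram, let μ ⊆ ν be partitions with at most n parts, and let R: μ = ρ^{(0)} → ρ^{(1)} → ⋯ → ρ^{(l)} = ν be a sequence of partitions with at most n parts. Then, in ℤ[a_i, b_i : i ∈ ℤ], (|a_ν| − |a_μ|)·𝒮(R) = Σ_{k=1}^{l} ( 𝒮_k^+(R) − 𝒮_k^−(R) ). -/
open scoped BigOperators

namespace FactorialLR

/-- The cells of the skew diagram `θo / θi`. -/
def skewCells (θi θo : YoungDiagram) : Finset (ℕ × ℕ) :=
  θo.cells \ θi.cells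

/-- The `n`-tuple `a_ρ = (a_{ρ_1+n}, a_{ρ_2+n-1}, …, a_{ρ_n+1})`; the `i`-th entry
(`0`-based `i`) is `a_{ρ_{i+1}+n-(i+1)+1}`. -/
noncomputable def subA {A : Type} [CommRing A] (n : ℕ) (a : ℤ → A) (ρ : YoungDiagram) :
    Fin n → A :=
  fun i => a ((ρ.rowLen i : ℤ) + (n : ℤ) - (i : ℤ))

/-- `|a_ρ| = a_{ρ_1+n} + ⋯ + a_{ρ_n+1}`. -/
noncomputable def aNorm {A : Type} [CommRing A] (n : ℕ) (a : ℤ → A) (ρ : YoungDiagram) : A :=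
  ∑ i : Fin n, subA n a ρ i

/-- For an unbarred cell `c`, `ρ(c) = ρ⁽ⁱ⁾` where `i` is maximal with `α_i < c` in
column order, i.e. `i` is the number of barred cells preceding `c`. -/
def rhoOf {s : Finset (ℕ × ℕ)} (L : List YoungDiagram)
    (β : Fin (L.length - 1) → s) (c : s) : YoungDiagram :=
  L.getD ((Finset.univ.filter
    (fun i : Fin (L.length - 1) => ColLT (β i : ℕ × ℕ) (c : ℕ × ℕ))).card) ⊥

/-- `𝒮(R) = Σ_{T ∈ 𝒯(θ,R)} ∏_{α unbarred} ((a_{ρ(α)})_{T(α)} − b_{T(α)+c(α)})`. -/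
noncomputable def Sbar {A : Type} [CommRing A] (n : ℕ) (s : Finset (ℕ × ℕ))
    (a b : ℤ → A) (L : List YoungDiagram) : A :=
  ∑ᶠ p ∈ TSet (n := n) s L,
    ∏ c : s,
      if ∃ i, p.2 i = c then 1
      else subA n a (rhoOf L p.2 c) (p.1 c)
            - b ((p.1 c : ℤ) + 1 + ((c : ℕ × ℕ).2 : ℤ) - ((c : ℕ × ℕ).1 : ℤ))

/-- `skipIdx k t` : the `1`-based index, among `{1,…,l} \ {k}`, of the `t`-th barred cell
(`t` being `0`-based), for tableaux in `𝒯_k(θ,R)`. -/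
def skipIdx (k t : ℕ) : ℕ :=
  if t + 1 < k then t + 1 else t + 2

/-- The index `i` with `ρ⁺(α) = ρ⁽ⁱ⁾` for an unbarred cell `α` preceded by `cnt` barred
cells: `ρ⁺(α) = ρ⁽ᵏ⁾` if `α_{k-1} < α < α_{k+1}` (i.e. `cnt = k − 1`), else `ρ(α)`. -/
def rhoIdxP (k cnt : ℕ) : ℕ :=
  if cnt + 1 < k then cnt else if cnt + 1 = k then k else cnt + 1

/-- The index `i` with `ρ⁻(α) = ρ⁽ⁱ⁾`: `ρ⁻(α) = ρ⁽ᵏ⁻¹⁾` if `α_{k-1} < α < α_{k+1}`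
(i.e. `cnt = k − 1`), else `ρ(α)`. -/
def rhoIdxM (k cnt : ℕ) : ℕ :=
  if cnt + 1 < k then cnt else if cnt + 1 = k then k - 1 else cnt + 1

/-- The set `𝒯_k(θ,R)`: pairs `(T,β)` where `T` is a semistandard filling of `s` and `β`
lists the barred cells `α_1 < ⋯ < α_{k-1} < α_{k+1} < ⋯ < α_l` in column order, with
`T(α_i) = r_i` for all `i ≠ k`. -/
def TkSet {n : ℕ} (s : Finset (ℕ × ℕ)) (L : List YoungDiagram) (k : ℕ) :
    Set ((s → Fin n) × (Fin (L.length - 1 - 1) → s)) :=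
  {p | IsSsyt s p.1 ∧
    (∀ i j : Fin (L.length - 1 - 1), i < j → ColLT (p.2 i : ℕ × ℕ) (p.2 j : ℕ × ℕ)) ∧
    (∀ t : Fin (L.length - 1 - 1),
      (p.1 (p.2 t) : ℕ) =
        stepRow (L.getD (skipIdx k (t : ℕ) - 1) ⊥) (L.getD (skipIdx k (t : ℕ)) ⊥))}

/-- `𝒮_k^+(R)` (for `pl = true`), resp. `𝒮_k^-(R)` (for `pl = false`):
`Σ_{T ∈ 𝒯_k(θ,R)} ∏_{α unbarred} ((a_{ρ^±(α)})_{T(α)} − b_{T(α)+c(α)})`. -/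
noncomputable def Skbar (pl : Bool) {A : Type} [CommRing A] (n : ℕ) (s : Finset (ℕ × ℕ))
    (a b : ℤ → A) (L : List YoungDiagram) (k : ℕ) : A :=
  ∑ᶠ p ∈ TkSet (n := n) s L k,
    ∏ c : s,
      if ∃ t, p.2 t = c then 1
      else subA n a
          (L.getD ((if pl then rhoIdxP else rhoIdxM) k
            ((Finset.univ.filter
              (fun t : Fin (L.length - 1 - 1) =>
                ColLT (p.2 t : ℕ × ℕ) (c : ℕ × ℕ))).card)) ⊥)
          (p.1 c)
        - b ((p.1 c : ℤ) + 1 + ((c : ℕ × ℕ).2 : ℤ) - ((c : ℕ × ℕ).1 : ℤ))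

lemma Covers.rowLen_eq {σ τ : YoungDiagram} (h : Covers σ τ) (i : ℕ) (hi : i ≠ stepRow σ τ) :
    τ.rowLen i = σ.rowLen i := by
  obtain ⟨hle, hc⟩ := h
  have hle' : σ.cells ⊆ τ.cells := hle
  have h1 : (τ.cells \ σ.cells).card = 1 := by
    rw [Finset.card_sdiff_of_subset hle']
    change τ.card - σ.card = 1
    omega
  obtain ⟨x, hx⟩ := Finset.card_eq_one.mp h1
  have hr : stepRow σ τ = x.1 := by simp [stepRow, hx]
  by_contra hne
  have hge : σ.rowLen i ≤ τ.rowLen i := by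
    by_contra hlt
    push Not at hlt
    have h2 : (i, τ.rowLen i) ∈ σ := YoungDiagram.mem_iff_lt_rowLen.mpr hlt
    have h3 : (i, τ.rowLen i) ∈ τ := hle h2
    have := YoungDiagram.mem_iff_lt_rowLen.mp h3
    omega
  have h2 : (i, σ.rowLen i) ∈ τ := YoungDiagram.mem_iff_lt_rowLen.mpr (by omega)
  have h3 : (i, σ.rowLen i) ∉ σ := fun h => by
    have := YoungDiagram.mem_iff_lt_rowLen.mp h
    omega
  have h4 : (i, σ.rowLen i) ∈ τ.cells \ σ.cells := Finset.mem_sdiff.mpr ⟨h2, h3⟩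
  rw [hx, Finset.mem_singleton] at h4
  apply hi
  rw [hr, ← h4]

lemma subA_sub {A : Type} [CommRing A] (n : ℕ) (a : ℤ → A) {σ τ : YoungDiagram}
    (h : Covers σ τ) (i : Fin n) :
    subA n a τ i - subA n a σ i =
      if (i : ℕ) = stepRow σ τ then aNorm n a τ - aNorm n a σ else 0 := by
  have key : ∀ j : Fin n, (j : ℕ) ≠ stepRow σ τ → subA n a τ j - subA n a σ j = 0 := by
    intro j hj
    simp [subA, h.rowLen_eq j hj]
  split_ifs with hi
  · rw [aNorm, aNorm, ← Finset.sum_sub_distrib, Finset.sum_eq_single i]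
    · intro j _ hj
      apply key
      intro hj'
      exact hj (Fin.ext (hj'.trans hi.symm))
    · simp
  · exact key i hi

lemma ColLT.irrefl (x : ℕ × ℕ) : ¬ ColLT x x := by simp [ColLT]
lemma ColLT.trans {x y z : ℕ × ℕ} (h : ColLT x y) (h' : ColLT y z) : ColLT x z := by
  unfold ColLT at *; omega
lemma ColLT.asymm {x y : ℕ × ℕ} (h : ColLT x y) : ¬ ColLT y x := by
  unfold ColLT at *; omega
lemma ColLT.total {x y : ℕ × ℕ} (h : x ≠ y) : ColLT x y ∨ ColLT y x := by
  have : x.1 ≠ y.1 ∨ x.2 ≠ y.2 := by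
    by_contra hh
    push Not at hh
    exact h (Prod.ext hh.1 hh.2)
  unfold ColLT; omega

/-- The telescoping identity along a linear order. -/
lemma prod_sub_prod_aux {A ι : Type} [CommRing A] [Fintype ι] [LinearOrder ι] (P M : ι → A)
    (lt : ι → ι → Prop) (hlt : ∀ x y : ι, x < y ↔ lt x y)
    [DecidableRel lt] [∀ x y : ι, Decidable (x = y)] :
    ∏ c, P c - ∏ c, M c =
      ∑ j : ι, (P j - M j) * ∏ c : ι, (if c = j then 1 else if lt c j then M c else P c) := by
  have h := Finset.prod_sub_ordered (Finset.univ : Finset ι) P (fun c => P c - M c)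
  simp only [sub_sub_cancel] at h
  rw [h, sub_sub_cancel]
  refine Finset.sum_congr rfl fun j _ => ?_
  rw [mul_assoc]
  congr 1
  rw [Finset.prod_filter, Finset.prod_filter, ← Finset.prod_mul_distrib]
  refine Finset.prod_congr rfl fun c _ => ?_
  rcases lt_trichotomy c j with hc | hc | hc
  · have h1 := (hlt _ _).mp hc
    simp [hc, hc.ne, h1, hc.not_gt]
  · simp [hc]
  · have h1 : ¬ lt c j := fun h => hc.not_gt ((hlt _ _).mpr h)
    simp [hc, hc.ne', h1, hc.not_gt]

/-- The telescoping identity along the column order. -/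
lemma prod_sub_prod {A : Type} [CommRing A] (s : Finset (ℕ × ℕ)) (P M : s → A) :
    ∏ c, P c - ∏ c, M c =
      ∑ j : s, (P j - M j) * ∏ c : s, (if c = j then 1 else
        if ColLT (c : ℕ × ℕ) (j : ℕ × ℕ) then M c else P c) := by
  let f : s → ℕᵒᵈ ×ₗ ℕ := fun x => toLex (OrderDual.toDual (x : ℕ × ℕ).2, (x : ℕ × ℕ).1)
  have hf : Function.Injective f := by
    intro x y hxy
    simp only [f, EmbeddingLike.apply_eq_iff_eq, Prod.mk.injEq] at hxy
    exact Subtype.ext (Prod.ext hxy.2 hxy.1)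
  have hlt : ∀ x y : s, f x < f y ↔ ColLT (x : ℕ × ℕ) (y : ℕ × ℕ) := by
    intro x y
    simp only [f, Prod.Lex.toLex_lt_toLex, OrderDual.toDual_lt_toDual, ColLT,
      EmbeddingLike.apply_eq_iff_eq]
  exact @prod_sub_prod_aux A s _ _ (LinearOrder.lift' f hf) P M
    (fun c j => ColLT (c : ℕ × ℕ) (j : ℕ × ℕ)) hlt _ _

/-- Number of cells of `β` preceding `c`. -/
def cnt {s : Finset (ℕ × ℕ)} {l : ℕ} (β : Fin l → s) (c : s) : ℕ :=
  (Finset.univ.filter (fun i : Fin l => ColLT (β i : ℕ × ℕ) (c : ℕ × ℕ))).card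

/-- Generic weight. -/
noncomputable def gw {A : Type} [CommRing A] {n : ℕ} {s : Finset (ℕ × ℕ)} (a b : ℤ → A) {l : ℕ}
    (idx : ℕ → YoungDiagram) (T : s → Fin n) (β : Fin l → s) : A :=
  ∏ c : s,
      if ∃ i, β i = c then 1
      else subA n a (idx (cnt β c)) (T c)
            - b ((T c : ℤ) + 1 + ((c : ℕ × ℕ).2 : ℤ) - ((c : ℕ × ℕ).1 : ℤ))

/-- Generic validity. -/
def Valid {n : ℕ} {s : Finset (ℕ × ℕ)} {l : ℕ}
    (r : ℕ → ℕ) (T : s → Fin n) (β : Fin l → s) : Prop :=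
  IsSsyt s T ∧ (∀ i j : Fin l, i < j → ColLT (β i : ℕ × ℕ) (β j : ℕ × ℕ)) ∧
    (∀ i : Fin l, (T (β i) : ℕ) = r i)

open Classical in
/-- Generic sum. -/
noncomputable def GS {A : Type} [CommRing A] (n : ℕ) (s : Finset (ℕ × ℕ)) (a b : ℤ → A) (l : ℕ)
    (idx : ℕ → YoungDiagram) (r : ℕ → ℕ) : A :=
  ∑ T : s → Fin n, ∑ β : Fin l → s, if Valid r T β then gw a b idx T β else 0

lemma finsum_GS {A : Type} [CommRing A] (n : ℕ) (s : Finset (ℕ × ℕ)) (a b : ℤ → A) (l : ℕ)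
    (idx : ℕ → YoungDiagram) (r : ℕ → ℕ) :
    (∑ᶠ p ∈ {p : (s → Fin n) × (Fin l → s) | Valid r p.1 p.2}, gw a b idx p.1 p.2) =
      GS n s a b l idx r := by
  classical
  rw [finsum_mem_def, finsum_eq_sum_of_fintype, Fintype.sum_prod_type]
  simp only [Set.indicator_apply, Set.mem_setOf_eq, GS]

lemma Sbar_eq {A : Type} [CommRing A] (n : ℕ) (s : Finset (ℕ × ℕ))
    (a b : ℤ → A) (L : List YoungDiagram) :
    Sbar n s a b L = GS n s a b (L.length - 1) (fun i => L.getD i ⊥)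
      (fun i => stepRow (L.getD i ⊥) (L.getD (i + 1) ⊥)) := by
  rw [← finsum_GS]; rfl

lemma Skbar_eq {A : Type} [CommRing A] (pl : Bool) (n : ℕ) (s : Finset (ℕ × ℕ))
    (a b : ℤ → A) (L : List YoungDiagram) (k : ℕ) :
    Skbar pl n s a b L k = GS n s a b (L.length - 1 - 1)
      (fun i => L.getD ((if pl then rhoIdxP else rhoIdxM) k i) ⊥)
      (fun t => stepRow (L.getD (skipIdx k t - 1) ⊥) (L.getD (skipIdx k t) ⊥)) := by
  rw [← finsum_GS]; rfl

lemma cnt_insertNth {s : Finset (ℕ × ℕ)} {m : ℕ} (p : Fin (m + 1)) (j : s) (β : Fin m → s)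
    (c : s) :
    cnt (Fin.insertNth (α := fun _ => s) p j β) c =
      (if ColLT (j : ℕ × ℕ) c then 1 else 0) + cnt β c := by
  unfold cnt
  rw [Finset.card_filter, Finset.card_filter, Fin.sum_univ_succAbove _ p]
  simp

lemma cnt_mono {s : Finset (ℕ × ℕ)} {m : ℕ} (β : Fin m → s) {c d : s}
    (h : ColLT (c : ℕ × ℕ) d) : cnt β c ≤ cnt β d := by
  refine Finset.card_le_card fun i => ?_
  simp only [Finset.mem_filter, Finset.mem_univ, true_and]
  exact fun hi => hi.trans h

lemma card_lt_s13 (m p : ℕ) (hp : p ≤ m) :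
    (Finset.univ.filter (fun t : Fin m => (t : ℕ) < p)).card = p := by
  rw [Fin.card_filter_val_lt]; omega

/-- The position of `j` is determined by the number of preceding cells. -/
lemma lt_iff_of_cnt {s : Finset (ℕ × ℕ)} {m : ℕ} (β : Fin m → s)
    (hβ : ∀ i j : Fin m, i < j → ColLT (β i : ℕ × ℕ) (β j : ℕ × ℕ)) (j : s) (t : Fin m) :
    ColLT (β t : ℕ × ℕ) j ↔ (t : ℕ) < cnt β j := by
  constructor
  · intro h
    have : Finset.univ.filter (fun u : Fin m => (u : ℕ) < t + 1) ⊆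
        Finset.univ.filter (fun i : Fin m => ColLT (β i : ℕ × ℕ) (j : ℕ × ℕ)) := by
      intro u
      simp only [Finset.mem_filter, Finset.mem_univ, true_and]
      intro hu
      rcases (Nat.lt_succ_iff.mp hu).lt_or_eq with h1 | h1
      · exact (hβ u t h1).trans h
      · rw [Fin.ext h1]; exact h
    have h2 := Finset.card_le_card this
    rw [card_lt_s13 _ _ t.isLt] at h2
    exact h2
  · intro h
    by_contra hn
    have : Finset.univ.filter (fun i : Fin m => ColLT (β i : ℕ × ℕ) (j : ℕ × ℕ)) ⊆
        Finset.univ.filter (fun u : Fin m => (u : ℕ) < t) := by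
      intro u
      simp only [Finset.mem_filter, Finset.mem_univ, true_and]
      intro hu
      by_contra h1
      push Not at h1
      rcases h1.lt_or_eq with h1 | h1
      · exact hn ((hβ t u h1).trans hu)
      · rw [Fin.ext h1] at hn; exact hn hu
    have h2 := Finset.card_le_card this
    rw [card_lt_s13 _ _ t.isLt.le] at h2
    unfold cnt at h
    omega

lemma valid_insertNth {n : ℕ} {s : Finset (ℕ × ℕ)} {m : ℕ} (p : Fin (m + 1))
    (r r' : ℕ → ℕ) (hr : ∀ t : Fin m, r' t = r (p.succAbove t))
    (T : s → Fin n) (j : s) (β : Fin m → s) :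
    Valid r T (Fin.insertNth (α := fun _ => s) p j β) ↔
      Valid r' T β ∧ (¬ ∃ t, β t = j) ∧ cnt β j = p ∧ (T j : ℕ) = r p := by
  unfold Valid
  constructor
  · rintro ⟨h1, h2, h3⟩
    have hb : ∀ t, ColLT (β t : ℕ × ℕ) j ↔ (t : ℕ) < p := by
      intro t
      constructor
      · intro h
        by_contra hn
        have h4 := h2 p (p.succAbove t) (by
          rw [Fin.lt_succAbove_iff_le_castSucc, Fin.le_def]; simpa using hn)
        simp only [Fin.insertNth_apply_same, Fin.insertNth_apply_succAbove] at h4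
        exact h.asymm h4
      · intro h
        have h4 := h2 (p.succAbove t) p (by
          rw [Fin.succAbove_lt_iff_castSucc_lt, Fin.lt_def]; simpa using h)
        simpa only [Fin.insertNth_apply_same, Fin.insertNth_apply_succAbove] using h4
    refine ⟨⟨h1, ?_, ?_⟩, ?_, ?_, ?_⟩
    · intro i k hik
      simpa using h2 (p.succAbove i) (p.succAbove k) (by simpa using hik)
    · intro t
      rw [hr]
      simpa using h3 (p.succAbove t)
    · rintro ⟨t, ht⟩
      rcases lt_or_gt_of_ne (Fin.succAbove_ne p t) with h | h
      · have := h2 _ _ h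
        simp only [Fin.insertNth_apply_same, Fin.insertNth_apply_succAbove, ht] at this
        exact ColLT.irrefl _ this
      · have := h2 _ _ h
        simp only [Fin.insertNth_apply_same, Fin.insertNth_apply_succAbove, ht] at this
        exact ColLT.irrefl _ this
    · unfold cnt
      simp only [hb]
      exact card_lt_s13 _ _ (Nat.lt_succ_iff.mp p.isLt)
    · simpa using h3 p
  · rintro ⟨⟨h1, h2, h3⟩, h4, h5, h6⟩
    have hb := lt_iff_of_cnt β h2 j
    rw [h5] at hb
    refine ⟨h1, ?_, ?_⟩
    · intro i k hik
      rcases Fin.eq_self_or_eq_succAbove p i with rfl | ⟨i, rfl⟩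
      · rcases Fin.eq_self_or_eq_succAbove i k with rfl | ⟨k, rfl⟩
        · exact absurd hik (lt_irrefl _)
        · simp only [Fin.insertNth_apply_same, Fin.insertNth_apply_succAbove]
          rw [Fin.lt_succAbove_iff_le_castSucc, Fin.le_def, Fin.val_castSucc] at hik
          have h7 : (β k : ℕ × ℕ) ≠ j := fun h => h4 ⟨k, Subtype.ext h⟩
          rcases ColLT.total h7 with h | h
          · have := (hb k).mp h
            omega
          · exact h
      · rcases Fin.eq_self_or_eq_succAbove p k with rfl | ⟨k, rfl⟩
        · simp only [Fin.insertNth_apply_same, Fin.insertNth_apply_succAbove]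
          rw [Fin.succAbove_lt_iff_castSucc_lt, Fin.lt_def, Fin.val_castSucc] at hik
          exact (hb i).mpr hik
        · simp only [Fin.insertNth_apply_succAbove]
          exact h2 i k (by simpa using hik)
    · intro i
      rcases Fin.eq_self_or_eq_succAbove p i with rfl | ⟨i, rfl⟩
      · simpa using h6
      · simp only [Fin.insertNth_apply_succAbove]
        rw [h3, hr]

lemma GS_step {A : Type} [CommRing A] (n : ℕ) (s : Finset (ℕ × ℕ)) (a b : ℤ → A) (m : ℕ)
    (ρ : ℕ → YoungDiagram) (p : Fin (m + 1)) (hcov : Covers (ρ p) (ρ (p + 1))) :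
    GS n s a b m (fun i => ρ (rhoIdxP (p + 1) i))
        (fun t => stepRow (ρ (skipIdx (p + 1) t - 1)) (ρ (skipIdx (p + 1) t))) -
      GS n s a b m (fun i => ρ (rhoIdxM (p + 1) i))
        (fun t => stepRow (ρ (skipIdx (p + 1) t - 1)) (ρ (skipIdx (p + 1) t))) =
    (aNorm n a (ρ (p + 1)) - aNorm n a (ρ p)) *
      GS n s a b (m + 1) ρ (fun i => stepRow (ρ i) (ρ (i + 1))) := by
  classical
  unfold GS
  rw [← Finset.sum_sub_distrib, Finset.mul_sum]
  refine Finset.sum_congr rfl fun T _ => ?_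
  rw [← (Fin.insertNthEquiv (fun _ => (s : Type)) p).sum_comp, Fintype.sum_prod_type_right,
    ← Finset.sum_sub_distrib, Finset.mul_sum]
  refine Finset.sum_congr rfl fun β _ => ?_
  simp only [Fin.insertNthEquiv, Equiv.coe_fn_mk]
  have hV := fun j => valid_insertNth p (fun i => stepRow (ρ i) (ρ (i + 1)))
    (fun t => stepRow (ρ (skipIdx (p + 1) t - 1)) (ρ (skipIdx (p + 1) t))) (by
      intro t
      unfold skipIdx
      by_cases h : (t : ℕ) < p
      · rw [Fin.succAbove_of_castSucc_lt _ _ (by rw [Fin.lt_def]; simpa using h)]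
        simp [h]
      · rw [Fin.succAbove_of_le_castSucc _ _ (by rw [Fin.le_def]; simpa using h)]
        simp [h]) T j β
  simp only [hV]
  by_cases hv : Valid (fun t => stepRow (ρ (skipIdx (p + 1) t - 1)) (ρ (skipIdx (p + 1) t))) T β
  swap
  · simp [hv]
  simp only [hv, if_true, true_and]
  unfold gw
  rw [prod_sub_prod, Finset.mul_sum]
  refine Finset.sum_congr rfl fun j _ => ?_
  by_cases h1 : ∃ t, β t = j
  · simp [h1]
  simp only [h1, if_false, not_false_eq_true, true_and]
  by_cases h2 : cnt β j = p
  swap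
  · have : rhoIdxP (p + 1) (cnt β j) = rhoIdxM (p + 1) (cnt β j) := by
      unfold rhoIdxP rhoIdxM
      split_ifs <;> omega
    simp [h2, this]
  have e1 : rhoIdxP (p + 1) (cnt β j) = p + 1 := by
    unfold rhoIdxP; split_ifs <;> omega
  have e2 : rhoIdxM (p + 1) (cnt β j) = p := by
    unfold rhoIdxM; split_ifs <;> omega
  rw [e1, e2, sub_sub_sub_cancel_right, subA_sub n a hcov]
  by_cases h3 : (T j : ℕ) = stepRow (ρ p) (ρ (p + 1))
  swap
  · simp [h3]
  simp only [h2, h3, if_true, and_self]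
  congr 1
  refine Finset.prod_congr rfl fun c _ => ?_
  have hex : (∃ i, Fin.insertNth (α := fun _ => (s : Type)) p j β i = c) ↔
      (j = c ∨ ∃ t, β t = c) := by
    rw [Fin.exists_iff_succAbove p]
    simp
  simp only [hex, cnt_insertNth]
  by_cases hc : c = j
  · simp [hc]
  have hc' : j ≠ c := fun h => hc h.symm
  by_cases hb : ∃ t, β t = c
  · simp [hc, hb]
  simp only [hc, hc', hb, if_false, or_self]
  rcases ColLT.total (fun h => hc (Subtype.ext h) : (c : ℕ × ℕ) ≠ j) with h | h
  · have e3 : rhoIdxM (p + 1) (cnt β c) = cnt β c := by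
      have := cnt_mono β h
      unfold rhoIdxM; split_ifs <;> omega
    simp [h, h.asymm, e3]
  · have e3 : rhoIdxP (p + 1) (cnt β c) = 1 + cnt β c := by
      have := cnt_mono β h
      unfold rhoIdxP; split_ifs <;> omega
    simp [h, h.asymm, e3]

lemma GS_total {A : Type} [CommRing A] (n : ℕ) (s : Finset (ℕ × ℕ)) (a b : ℤ → A) (l : ℕ)
    (ρ : ℕ → YoungDiagram) (hcov : ∀ i < l, Covers (ρ i) (ρ (i + 1))) :
    (aNorm n a (ρ l) - aNorm n a (ρ 0)) *
      GS n s a b l ρ (fun i => stepRow (ρ i) (ρ (i + 1))) =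
    ∑ k ∈ Finset.Icc 1 l,
      (GS n s a b (l - 1) (fun i => ρ (rhoIdxP k i))
        (fun t => stepRow (ρ (skipIdx k t - 1)) (ρ (skipIdx k t))) -
      GS n s a b (l - 1) (fun i => ρ (rhoIdxM k i))
        (fun t => stepRow (ρ (skipIdx k t - 1)) (ρ (skipIdx k t)))) := by
  rw [← Finset.sum_range_sub (fun i => aNorm n a (ρ i)), Finset.sum_mul,
    ← Finset.Ico_succ_right_eq_Icc, Finset.sum_Ico_eq_sum_range]
  refine Finset.sum_congr (by simp) fun i hi => ?_
  replace hi : i < l := by simpa using hi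
  obtain ⟨m, rfl⟩ : ∃ m, l = m + 1 := ⟨l - 1, by omega⟩
  rw [add_comm 1 i]
  exact (GS_step n s a b m ρ ⟨i, hi⟩ (hcov i hi)).symm

/-- `(|a_ν| − |a_μ|)·𝒮(R) = Σ_{k=1}^{l} (𝒮_k^+(R) − 𝒮_k^-(R))` in `ℤ[a_i, b_i : i ∈ ℤ]`. -/
theorem S_plus_minus (n : ℕ) (hn : 1 ≤ n) (θi θo : YoungDiagram) (hθ : θi ≤ θo)
    (mu nu : YoungDiagram) (hmu : mu.colLen 0 ≤ n) (hnu : nu.colLen 0 ≤ n) (hsub : mu ≤ nu)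
    (L : List YoungDiagram) (hL : L ∈ chainSet mu nu)
    (hparts : ∀ σ ∈ L, σ.colLen 0 ≤ n) :
    (aNorm n (fun k => (MvPolynomial.X (Sum.inl k) : MvPolynomial (ℤ ⊕ ℤ) ℤ)) nu
        - aNorm n (fun k => MvPolynomial.X (Sum.inl k)) mu) *
      Sbar n (skewCells θi θo) (fun k => MvPolynomial.X (Sum.inl k))
        (fun k => MvPolynomial.X (Sum.inr k)) L =
    ∑ k ∈ Finset.Icc 1 (L.length - 1),
      (Skbar true n (skewCells θi θo) (fun k => MvPolynomial.X (Sum.inl k))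
          (fun k => MvPolynomial.X (Sum.inr k)) L k
        - Skbar false n (skewCells θi θo) (fun k => MvPolynomial.X (Sum.inl k))
            (fun k => MvPolynomial.X (Sum.inr k)) L k) := by
  obtain ⟨hch, hhd, hlast⟩ := hL
  simp only [Sbar_eq, Skbar_eq]
  have h0 : L.getD 0 ⊥ = mu := by
    rw [List.getD_eq_getElem?_getD, ← List.head?_eq_getElem?, hhd]; rfl
  have hl : L.getD (L.length - 1) ⊥ = nu := by
    rw [List.getD_eq_getElem?_getD, ← List.getLast?_eq_getElem?, hlast]; rfl
  have hcov : ∀ i < L.length - 1, Covers (L.getD i ⊥) (L.getD (i + 1) ⊥) := by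
    intro i hi
    have h := List.isChain_iff_getElem.mp hch i (by omega)
    rw [List.getD_eq_getElem _ _ (by omega), List.getD_eq_getElem _ _ (by omega)]
    exact h
  have := GS_total n (skewCells θi θo)
    (fun k => (MvPolynomial.X (Sum.inl k) : MvPolynomial (ℤ ⊕ ℤ) ℤ))
    (fun k => MvPolynomial.X (Sum.inr k)) (L.length - 1) (fun i => L.getD i ⊥) hcov
  simp only [h0, hl] at this
  exact this

end FactorialLR
end
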